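/- arXiv:1603.00280 — 4 statements merged into one kernel-verified Lean document; each statement's English description precedes it below -/
import Mathlib

section
/- For t > 0 define on ℝ² the chord distance d̃_t(x,y) := W_c(μ_x^t, μ_y^t) and let d_t be the length distance induced by d̃_t. Then for all x, y ∈ ℝ² and all t > 0 one has d̃_t(x,y) ≤ d_t(x,y) ≤ min(|x−y|, |x+y|), and d_t(x,y) → min(|x−y|, |x+y|) as t → 0⁺; i.e. the convoluted distances on the cone C(π) converge pointwise to the cone distance as t goes to zero. -/
open MeasureTheory ENNReal

/-- A coupling of two measures: a measure on the product whose marginals are the two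
given measures. -/
def IsCoupling {Y : Type*} [MeasurableSpace Y] (π : Measure (Y × Y)) (μ ν : Measure Y) : Prop :=
  π.map Prod.fst = μ ∧ π.map Prod.snd = ν

/-- The (squared) optimal transport cost for the quadratic cost built from `c`. -/
noncomputable def transportCost {Y : Type*} [MeasurableSpace Y] (c : Y → Y → ℝ)
    (μ ν : Measure Y) : ℝ≥0∞ :=
  ⨅ (π : Measure (Y × Y)) (_ : IsCoupling π μ ν), ∫⁻ p, ENNReal.ofReal (c p.1 p.2 ^ 2) ∂π

/-- The `L²`-Wasserstein distance associated to the cost `c`. -/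
noncomputable def W2 {Y : Type*} [MeasurableSpace Y] (c : Y → Y → ℝ) (μ ν : Measure Y) : ℝ :=
  Real.sqrt (transportCost c μ ν).toReal

/-- A measure on a metric space has finite second moment. -/
def HasFiniteSecondMoment {X : Type*} [MetricSpace X] [MeasurableSpace X] (μ : Measure X) :
    Prop :=
  ∃ x₀ : X, ∫⁻ x, ENNReal.ofReal (dist x₀ x ^ 2) ∂μ < ⊤

/-- A partition `0 = s 0 < s 1 < ⋯ < s N = 1` of `[0,1]`. -/
def IsPartition (N : ℕ) (s : ℕ → ℝ) : Prop :=
  s 0 = 0 ∧ s N = 1 ∧ ∀ i < N, s i < s (i + 1)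

/-- The length of the curve `γ : [0,1] → Y` with respect to the distance `ρ`, as the
supremum over partitions of sums of consecutive `ρ`-distances. -/
noncomputable def curveLength {Y : Type*} (ρ : Y → Y → ℝ) (γ : ℝ → Y) : ℝ≥0∞ :=
  ⨆ (N : ℕ) (s : ℕ → ℝ) (_ : IsPartition N s),
    ENNReal.ofReal (∑ i ∈ Finset.range N, ρ (γ (s i)) (γ (s (i + 1))))

/-- Continuity of a curve `γ : [0,1] → Y` with respect to the distance `ρ`. -/
def RhoContinuousCurve {Y : Type*} (ρ : Y → Y → ℝ) (γ : ℝ → Y) : Prop :=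
  ∀ s ∈ Set.Icc (0:ℝ) 1, ∀ ε > 0, ∃ δ > 0, ∀ s' ∈ Set.Icc (0:ℝ) 1,
    |s' - s| < δ → ρ (γ s) (γ s') < ε

/-- The length distance induced by the distance `ρ`. -/
noncomputable def lengthDist {Y : Type*} (ρ : Y → Y → ℝ) (x y : Y) : ℝ≥0∞ :=
  ⨅ (γ : ℝ → Y) (_ : RhoContinuousCurve ρ γ ∧ γ 0 = x ∧ γ 1 = y), curveLength ρ γ

/-- A metric space is a length space: the distance coincides with the induced length
distance. -/
def IsLengthSpace (X : Type*) [MetricSpace X] : Prop :=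
  ∀ x y : X, lengthDist (fun a b => dist a b) x y = ENNReal.ofReal (dist x y)

/-- The Gaussian measure on `ℝ²` centered at `x` with variance `2t` (heat kernel at
time `t`). -/
noncomputable def gauss2 (t : ℝ) (x : EuclideanSpace ℝ (Fin 2)) :
    Measure (EuclideanSpace ℝ (Fin 2)) :=
  volume.withDensity fun y =>
    ENNReal.ofReal ((4 * Real.pi * t)⁻¹ * Real.exp (-‖y - x‖ ^ 2 / (4 * t)))

/-- The symmetric lift `μ_x^t = ½(γ_x^t + γ_{-x}^t)` of the heat kernel measure on the
cone `C(π)` centered at the class of `x` (with `μ_x^0 = ½(δ_x + δ_{-x})`). -/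
noncomputable def symGauss (t : ℝ) (x : EuclideanSpace ℝ (Fin 2)) :
    Measure (EuclideanSpace ℝ (Fin 2)) :=
  if t = 0 then (2 : ℝ≥0∞)⁻¹ • (Measure.dirac x + Measure.dirac (-x))
  else (2 : ℝ≥0∞)⁻¹ • (gauss2 t x + gauss2 t (-x))

/-- The cone cost on `ℝ²`: the lift of the cone distance of `C(π)`. -/
noncomputable def coneCost (x y : EuclideanSpace ℝ (Fin 2)) : ℝ :=
  min ‖x - y‖ ‖x + y‖
open Filter Topology

local notation "Plane" => EuclideanSpace ℝ (Fin 2)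

theorem measurable_gauss2_density (t : ℝ) (x : Plane) :
    Measurable fun y : Plane =>
      ENNReal.ofReal ((4 * Real.pi * t)⁻¹ * Real.exp (-‖y - x‖ ^ 2 / (4 * t))) := by
  fun_prop

theorem map_sub_gauss2 (t : ℝ) (x a : Plane) :
    (gauss2 t x).map (fun y => y - a) = gauss2 t (x - a) := by
  ext s hs
  have hm : Measurable fun y : Plane => y - a := by fun_prop
  rw [Measure.map_apply hm hs, gauss2, gauss2, withDensity_apply _ (hm hs),
    withDensity_apply _ hs, ← lintegral_indicator (hm hs), ← lintegral_indicator hs]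
  symm
  rw [← lintegral_sub_right_eq_self _ a]
  refine lintegral_congr fun y => ?_
  by_cases h : y - a ∈ s
  · rw [Set.indicator_of_mem h, Set.indicator_of_mem (show y ∈ (fun y => y - a) ⁻¹' s from h),
      sub_sub_sub_cancel_right]
  · rw [Set.indicator_of_notMem h,
      Set.indicator_of_notMem (show y ∉ (fun y => y - a) ⁻¹' s from h)]

theorem gauss2_zero_univ {t : ℝ} (ht : 0 < t) : gauss2 t 0 Set.univ = 1 := by
  have hb : 0 < (4 * t)⁻¹ := by positivity
  have hI := GaussianFourier.integral_rexp_neg_mul_sq_norm (V := Plane) hb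
  have he : ∀ y : Plane, Real.exp (-‖y - 0‖ ^ 2 / (4 * t)) =
      Real.exp (-(4 * t)⁻¹ * ‖y‖ ^ 2) := fun y => by
    rw [sub_zero]; congr 1; ring
  have hval : ∫ y : Plane, Real.exp (-(4 * t)⁻¹ * ‖y‖ ^ 2) = 4 * Real.pi * t := by
    rw [hI, finrank_euclideanSpace_fin, div_inv_eq_mul]; norm_num; ring
  have hint : Integrable fun y : Plane => Real.exp (-(4 * t)⁻¹ * ‖y‖ ^ 2) := by
    by_contra h
    rw [integral_undef h] at hval
    have : 0 < 4 * Real.pi * t := by positivity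
    linarith
  rw [gauss2, withDensity_apply _ MeasurableSet.univ, Measure.restrict_univ]
  simp_rw [he]
  rw [← ofReal_integral_eq_lintegral_ofReal (hint.const_mul _)
    (ae_of_all _ fun y => by positivity), integral_const_mul, hval,
    inv_mul_cancel₀ (by positivity), ofReal_one]

theorem gauss2_univ {t : ℝ} (ht : 0 < t) (x : Plane) : gauss2 t x Set.univ = 1 := by
  have h := map_sub_gauss2 t 0 (-x)
  rw [zero_sub, neg_neg] at h
  rw [← h, Measure.map_apply (by fun_prop) MeasurableSet.univ, Set.preimage_univ,
    gauss2_zero_univ ht]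

theorem lintegral_norm_sub_gauss2_le {t : ℝ} (ht : 0 < t) (x : Plane) :
    ∫⁻ p, ENNReal.ofReal ‖p - x‖ ∂gauss2 t x ≤ ENNReal.ofReal (4 * √t) := by
  have hs : 0 < √t := Real.sqrt_pos.2 ht
  have hst : √t ^ 2 = t := Real.sq_sqrt ht.le
  have key : ∀ p : Plane,
      ENNReal.ofReal ((4 * Real.pi * t)⁻¹ * Real.exp (-‖p - x‖ ^ 2 / (4 * t))) *
        ENNReal.ofReal ‖p - x‖ ≤ ENNReal.ofReal (4 * √t) *
      ENNReal.ofReal ((4 * Real.pi * (2 * t))⁻¹ *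
        Real.exp (-‖p - x‖ ^ 2 / (4 * (2 * t)))) := fun p => by
    rw [← ENNReal.ofReal_mul (by positivity), ← ENNReal.ofReal_mul (by positivity)]
    refine ENNReal.ofReal_le_ofReal ?_
    set r := ‖p - x‖
    set u := r ^ 2 / (8 * t) with hu
    have h1 : -r ^ 2 / (4 * t) = -u + -u := by rw [hu]; field_simp; ring
    have h2 : -r ^ 2 / (4 * (2 * t)) = -u := by rw [hu]; field_simp; ring
    rw [h1, h2, Real.exp_add]
    have hr : r ≤ √t * (u + 2) := by
      have : √t * (u + 2) - r = √t * (r / √t - 4) ^ 2 / 8 := by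
        rw [hu]
        nth_rewrite 2 [← hst]
        field_simp
        ring
      have h0 : 0 ≤ √t * (r / √t - 4) ^ 2 / 8 := by positivity
      linarith
    have hu0 : 0 ≤ u := by positivity
    have hexp : r * Real.exp (-u) ≤ 2 * √t := by
      have h3 : u + 2 ≤ 2 * Real.exp u := by linarith [Real.add_one_le_exp u]
      calc r * Real.exp (-u) ≤ √t * (2 * Real.exp u) * Real.exp (-u) := by gcongr; nlinarith
        _ = 2 * √t * (Real.exp u * Real.exp (-u)) := by ring
        _ = 2 * √t := by rw [← Real.exp_add]; simp
    calc (4 * Real.pi * t)⁻¹ * (Real.exp (-u) * Real.exp (-u)) * r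
        = (4 * Real.pi * t)⁻¹ * Real.exp (-u) * (r * Real.exp (-u)) := by ring
      _ ≤ (4 * Real.pi * t)⁻¹ * Real.exp (-u) * (2 * √t) := by gcongr
      _ = _ := by field_simp; ring
  calc ∫⁻ p, ENNReal.ofReal ‖p - x‖ ∂gauss2 t x
      = ∫⁻ p, ENNReal.ofReal ((4 * Real.pi * t)⁻¹ * Real.exp (-‖p - x‖ ^ 2 / (4 * t))) *
          ENNReal.ofReal ‖p - x‖ := by
        rw [gauss2, lintegral_withDensity_eq_lintegral_mul _
          (measurable_gauss2_density t x) (by fun_prop)]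
        rfl
    _ ≤ _ := lintegral_mono key
    _ = ENNReal.ofReal (4 * √t) * gauss2 (2 * t) x Set.univ := by
        rw [lintegral_const_mul _ (measurable_gauss2_density (2 * t) x), gauss2,
          withDensity_apply _ MeasurableSet.univ, Measure.restrict_univ]
    _ = ENNReal.ofReal (4 * √t) := by rw [gauss2_univ (by positivity), mul_one]

theorem symGauss_of_pos {t : ℝ} (ht : 0 < t) (x : Plane) :
    symGauss t x = (2 : ℝ≥0∞)⁻¹ • (gauss2 t x + gauss2 t (-x)) := if_neg ht.ne'

theorem symGauss_neg (t : ℝ) (x : Plane) : symGauss t (-x) = symGauss t x := by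
  simp only [symGauss, neg_neg, add_comm]

theorem inv_two_mul_add_self (a : ℝ≥0∞) : (2 : ℝ≥0∞)⁻¹ * (a + a) = a := by
  rw [← two_mul, ← mul_assoc, ENNReal.inv_mul_cancel (by simp) (by simp), one_mul]

theorem symGauss_univ {t : ℝ} (ht : 0 < t) (x : Plane) : symGauss t x Set.univ = 1 := by
  rw [symGauss_of_pos ht, Measure.smul_apply, Measure.add_apply, gauss2_univ ht,
    gauss2_univ ht, smul_eq_mul, inv_two_mul_add_self]

theorem coneCost_nonneg (x y : Plane) : 0 ≤ coneCost x y :=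
  le_min (norm_nonneg _) (norm_nonneg _)

theorem coneCost_comm (x y : Plane) : coneCost x y = coneCost y x := by
  rw [coneCost, coneCost, norm_sub_rev, add_comm]

theorem coneCost_triangle (x y z : Plane) : coneCost x z ≤ coneCost x y + coneCost y z := by
  have h1 := norm_add_le (x - y) (y - z)
  have h2 := norm_add_le (x - y) (y + z)
  have h3 := norm_sub_le (x + y) (y + z)
  have h4 := norm_sub_le (x + y) (y - z)
  rw [show x - y + (y - z) = x - z by abel] at h1
  rw [show x - y + (y + z) = x + z by abel] at h2
  rw [show x + y - (y + z) = x - z by abel] at h3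
  rw [show x + y - (y - z) = x + z by abel] at h4
  simp only [coneCost]
  rcases min_cases ‖x - y‖ ‖x + y‖ with h | h <;>
    rcases min_cases ‖y - z‖ ‖y + z‖ with h' | h' <;> rw [h.1, h'.1] <;>
    first
      | exact (min_le_left _ _).trans ‹_›
      | exact (min_le_right _ _).trans ‹_›

@[fun_prop]
theorem Measurable.coneCost {α : Type*} [MeasurableSpace α] {f : α → Plane} (hf : Measurable f)
    (x : Plane) : Measurable fun a => coneCost x (f a) := by
  unfold _root_.coneCost
  fun_prop

theorem lintegral_coneCost_symGauss_le {t : ℝ} (ht : 0 < t) (x : Plane) :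
    ∫⁻ p, ENNReal.ofReal (coneCost x p) ∂symGauss t x ≤ ENNReal.ofReal (4 * √t) := by
  rw [symGauss_of_pos ht, lintegral_smul_measure, lintegral_add_measure, smul_eq_mul,
    ← inv_two_mul_add_self (ENNReal.ofReal (4 * √t))]
  gcongr
  · refine (lintegral_mono fun p => ?_).trans (lintegral_norm_sub_gauss2_le ht x)
    refine ENNReal.ofReal_le_ofReal ((min_le_left _ _).trans_eq (norm_sub_rev _ _))
  · refine (lintegral_mono fun p => ?_).trans (lintegral_norm_sub_gauss2_le ht (-x))
    refine ENNReal.ofReal_le_ofReal ((min_le_right _ _).trans_eq ?_)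
    rw [sub_neg_eq_add, add_comm]

theorem transportCost_symGauss_le {t : ℝ} (ht : 0 < t) (a b : Plane) :
    transportCost coneCost (symGauss t a) (symGauss t b) ≤ ENNReal.ofReal (‖a - b‖ ^ 2) := by
  have hm : ∀ v : Plane, Measurable fun p : Plane => (p, p - v) := fun v => by fun_prop
  have hfst : ∀ (c v : Plane), ((gauss2 t c).map fun p => (p, p - v)).map Prod.fst =
      gauss2 t c := fun c v => by
    rw [Measure.map_map measurable_fst (hm v)]; exact Measure.map_id
  have hsnd : ∀ (c v : Plane), ((gauss2 t c).map fun p => (p, p - v)).map Prod.snd =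
      gauss2 t (c - v) := fun c v => by
    rw [Measure.map_map measurable_snd (hm v)]; exact map_sub_gauss2 t c v
  have hcost : ∀ (c v : Plane), ‖v‖ ≤ ‖a - b‖ →
      ∫⁻ p, ENNReal.ofReal (coneCost p.1 p.2 ^ 2) ∂((gauss2 t c).map fun p => (p, p - v)) ≤
        ENNReal.ofReal (‖a - b‖ ^ 2) := fun c v hv => by
    refine (lintegral_map_le _ _).trans ?_
    calc _ ≤ ∫⁻ _, ENNReal.ofReal (‖a - b‖ ^ 2) ∂gauss2 t c := by
          refine lintegral_mono fun p => ENNReal.ofReal_le_ofReal ?_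
          refine pow_le_pow_left₀ (coneCost_nonneg _ _) ((min_le_left _ _).trans ?_) 2
          simpa only [_root_.sub_sub_cancel] using hv
      _ = _ := by rw [lintegral_const, gauss2_univ ht, mul_one]
  set π : Measure (Plane × Plane) :=
    (2 : ℝ≥0∞)⁻¹ • ((gauss2 t a).map (fun p => (p, p - (a - b))) +
      (gauss2 t (-a)).map (fun p => (p, p - (b - a)))) with hπ
  have hcoup : IsCoupling π (symGauss t a) (symGauss t b) := by
    constructor
    · rw [hπ, Measure.map_smul, Measure.map_add _ _ measurable_fst, hfst, hfst,
        symGauss_of_pos ht]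
    · rw [hπ, Measure.map_smul, Measure.map_add _ _ measurable_snd, hsnd, hsnd,
        symGauss_of_pos ht, _root_.sub_sub_cancel, show -a - (b - a) = -b by abel]
  refine (iInf₂_le π hcoup).trans ?_
  rw [hπ, lintegral_smul_measure, lintegral_add_measure, smul_eq_mul,
    ← inv_two_mul_add_self (ENNReal.ofReal (‖a - b‖ ^ 2))]
  gcongr
  · exact hcost _ _ le_rfl
  · exact hcost _ _ (norm_sub_rev _ _).le

theorem W2_symGauss_le {t : ℝ} (ht : 0 < t) (a b : Plane) :
    W2 coneCost (symGauss t a) (symGauss t b) ≤ ‖a - b‖ :=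
  Real.sqrt_le_iff.2 ⟨norm_nonneg _,
    ENNReal.toReal_le_of_le_ofReal (by positivity) (transportCost_symGauss_le ht a b)⟩

theorem sq_le_transportCost_symGauss {t : ℝ} (ht : 0 < t) (x y : Plane)
    (h : 0 ≤ coneCost x y - 8 * √t) :
    ENNReal.ofReal ((coneCost x y - 8 * √t) ^ 2) ≤
      transportCost coneCost (symGauss t x) (symGauss t y) := by
  set l := coneCost x y - 8 * √t with hl
  refine le_iInf₂ fun π hπ => ?_
  have hπ1 : π Set.univ = 1 := by
    rw [← symGauss_univ ht x, ← hπ.1, Measure.map_apply measurable_fst MeasurableSet.univ,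
      Set.preimage_univ]
  have hmx : Measurable fun p : Plane => ENNReal.ofReal (coneCost x p) := by
    fun_prop
  have hmy : Measurable fun p : Plane => ENNReal.ofReal (coneCost y p) := by
    fun_prop
  have hx : ∫⁻ p, ENNReal.ofReal (coneCost x p.1) ∂π ≤ ENNReal.ofReal (4 * √t) := by
    rw [← lintegral_map hmx measurable_fst, hπ.1]
    exact lintegral_coneCost_symGauss_le ht x
  have hy : ∫⁻ p, ENNReal.ofReal (coneCost y p.2) ∂π ≤ ENNReal.ofReal (4 * √t) := by
    rw [← lintegral_map hmy measurable_snd, hπ.2]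
    exact lintegral_coneCost_symGauss_le ht y
  have hpt : ∀ p : Plane × Plane, ENNReal.ofReal (2 * l * coneCost x y) ≤
      ENNReal.ofReal (coneCost p.1 p.2 ^ 2) + (ENNReal.ofReal (l ^ 2) +
        ENNReal.ofReal (2 * l) *
          (ENNReal.ofReal (coneCost x p.1) + ENNReal.ofReal (coneCost y p.2))) := fun p => by
    have h1 := coneCost_nonneg x p.1
    have h2 := coneCost_nonneg y p.2
    rw [← ENNReal.ofReal_add h1 h2, ← ENNReal.ofReal_mul (by positivity),
      ← ENNReal.ofReal_add (by positivity) (by positivity),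
      ← ENNReal.ofReal_add (by positivity) (by positivity)]
    refine ENNReal.ofReal_le_ofReal ?_
    have h3 := coneCost_triangle x p.1 y
    have h4 := coneCost_triangle p.1 p.2 y
    rw [coneCost_comm p.2 y] at h4
    nlinarith [sq_nonneg (coneCost p.1 p.2 - l)]
  have hint := lintegral_mono (μ := π) hpt
  rw [lintegral_const, hπ1, mul_one, lintegral_add_right _ (by fun_prop),
    lintegral_add_right _ (by fun_prop), lintegral_const, hπ1, mul_one,
    lintegral_const_mul _ (by fun_prop), lintegral_add_right _ (by fun_prop)] at hint
  have hbound : ENNReal.ofReal (2 * l * coneCost x y) ≤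
      (∫⁻ p, ENNReal.ofReal (coneCost p.1 p.2 ^ 2) ∂π) +
        ENNReal.ofReal (l ^ 2 + 2 * l * (8 * √t)) := by
    refine hint.trans ?_
    rw [ENNReal.ofReal_add (by positivity) (by positivity),
      ENNReal.ofReal_mul (p := 2 * l) (by positivity),
      show 8 * √t = 4 * √t + 4 * √t by ring, ENNReal.ofReal_add (by positivity) (by positivity)]
    gcongr
  rw [← tsub_le_iff_right, ← ENNReal.ofReal_sub _ (by positivity)] at hbound
  refine le_trans (le_of_eq ?_) hbound
  congr 1
  rw [hl]; ring

theorem coneCost_sub_le_W2_symGauss {t : ℝ} (ht : 0 < t) (x y : Plane) :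
    coneCost x y - 8 * √t ≤ W2 coneCost (symGauss t x) (symGauss t y) := by
  rcases le_total 0 (coneCost x y - 8 * √t) with h | h
  · refine Real.le_sqrt_of_sq_le ?_
    rw [← ENNReal.ofReal_le_iff_le_toReal
      ((transportCost_symGauss_le ht x y).trans_lt ENNReal.ofReal_lt_top).ne]
    exact sq_le_transportCost_symGauss ht x y h
  · exact h.trans (Real.sqrt_nonneg _)

theorem ofReal_le_lengthDist {Y : Type*} (ρ : Y → Y → ℝ) (x y : Y) :
    ENNReal.ofReal (ρ x y) ≤ lengthDist ρ x y := by
  refine le_iInf₂ fun γ hγ => ?_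
  refine le_trans ?_ (le_iSup_of_le 1 (le_iSup₂_of_le (fun i : ℕ => (i : ℝ))
    ⟨by simp, by simp, by simp⟩ le_rfl))
  simp [hγ.2.1, hγ.2.2]

/-- If `ρ` is dominated by the norm distance and does not separate `y` from `z`, the segment
from `x` to `z` bounds the length distance from `x` to `y`. -/
theorem lengthDist_le_norm_sub {V : Type*} [NormedAddCommGroup V] [NormedSpace ℝ V]
    (ρ : V → V → ℝ) (hρ : ∀ a b, ρ a b ≤ ‖a - b‖) {y z : V}
    (hl : ∀ a, ρ y a = ρ z a) (hr : ∀ a, ρ a y = ρ a z) {x : V} :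
    lengthDist ρ x y ≤ ENNReal.ofReal ‖x - z‖ := by
  set γ : ℝ → V := fun s => if s = 1 then y else x + s • (z - x) with hγ
  have hbound : ∀ s s', ρ (γ s) (γ s') ≤ |s' - s| * ‖x - z‖ := fun s s' => by
    have h1 : ∀ s a, ρ (γ s) a = ρ (x + s • (z - x)) a := fun s a => by
      by_cases h : s = 1 <;> simp [hγ, h, hl]
    have h2 : ∀ s a, ρ a (γ s) = ρ a (x + s • (z - x)) := fun s a => by
      by_cases h : s = 1 <;> simp [hγ, h, hr]
    rw [h1, h2]
    refine (hρ _ _).trans_eq ?_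
    rw [add_sub_add_left_eq_sub, ← sub_smul, norm_smul, Real.norm_eq_abs, abs_sub_comm,
      norm_sub_rev z x]
  have hcont : RhoContinuousCurve ρ γ := fun s _ ε hε => by
    refine ⟨ε / (‖x - z‖ + 1), by positivity, fun s' _ h => (hbound s s').trans_lt ?_⟩
    rw [lt_div_iff₀ (by positivity)] at h
    nlinarith [abs_nonneg (s' - s)]
  refine (iInf₂_le γ ⟨hcont, by simp [hγ], by simp [hγ]⟩).trans ?_
  refine iSup_le fun N => iSup₂_le fun s hs => ENNReal.ofReal_le_ofReal ?_
  calc ∑ i ∈ Finset.range N, ρ (γ (s i)) (γ (s (i + 1)))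
      ≤ ∑ i ∈ Finset.range N, (s (i + 1) - s i) * ‖x - z‖ := by
        refine Finset.sum_le_sum fun i hi => (hbound _ _).trans_eq ?_
        rw [abs_of_pos (sub_pos.2 (hs.2.2 i (Finset.mem_range.1 hi)))]
    _ = ‖x - z‖ := by
        rw [← Finset.sum_mul, Finset.sum_range_sub, hs.1, hs.2.1, sub_zero, one_mul]

theorem lengthDist_symGauss_le {t : ℝ} (ht : 0 < t) (x y : Plane) :
    lengthDist (fun a b => W2 coneCost (symGauss t a) (symGauss t b)) x y ≤
      ENNReal.ofReal (min ‖x - y‖ ‖x + y‖) := by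
  rcases min_choice ‖x - y‖ ‖x + y‖ with h | h <;> rw [h]
  · exact lengthDist_le_norm_sub _ (W2_symGauss_le ht) (fun _ => rfl) fun _ => rfl
  · rw [← sub_neg_eq_add]
    exact lengthDist_le_norm_sub _ (W2_symGauss_le ht) (fun _ => by simp only [symGauss_neg])
      fun _ => by simp only [symGauss_neg]

/-- `d̃_t ≤ d_t ≤ cone distance` and pointwise convergence of the
convoluted distances `d_t` to the cone distance as `t → 0⁺`. -/
theorem stmt11 :
    ∀ x y : EuclideanSpace ℝ (Fin 2),
      (∀ t : ℝ, 0 < t →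
        ENNReal.ofReal (W2 coneCost (symGauss t x) (symGauss t y)) ≤
          lengthDist (fun a b => W2 coneCost (symGauss t a) (symGauss t b)) x y ∧
        lengthDist (fun a b => W2 coneCost (symGauss t a) (symGauss t b)) x y ≤
          ENNReal.ofReal (min ‖x - y‖ ‖x + y‖)) ∧
      Filter.Tendsto
        (fun t => lengthDist (fun a b => W2 coneCost (symGauss t a) (symGauss t b)) x y)
        (nhdsWithin 0 (Set.Ioi 0))
        (nhds (ENNReal.ofReal (min ‖x - y‖ ‖x + y‖))) := by
  intro x y
  refine ⟨fun t ht => ⟨ofReal_le_lengthDist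
    (fun a b => W2 coneCost (symGauss t a) (symGauss t b)) x y, lengthDist_symGauss_le ht x y⟩, ?_⟩
  have hlim : Tendsto (fun t : ℝ => ENNReal.ofReal (min ‖x - y‖ ‖x + y‖ - 8 * √t))
      (𝓝[>] 0) (𝓝 (ENNReal.ofReal (min ‖x - y‖ ‖x + y‖))) := by
    refine ENNReal.tendsto_ofReal (tendsto_nhdsWithin_of_tendsto_nhds ?_)
    have hc : Continuous fun t : ℝ => min ‖x - y‖ ‖x + y‖ - 8 * √t := by fun_prop
    simpa using hc.tendsto 0
  refine tendsto_of_tendsto_of_tendsto_of_le_of_le' hlim tendsto_const_nhds ?_ ?_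
  · filter_upwards [self_mem_nhdsWithin] with t ht
    exact (ENNReal.ofReal_le_ofReal (coneCost_sub_le_W2_symGauss ht x y)).trans
      (ofReal_le_lengthDist (fun a b => W2 coneCost (symGauss t a) (symGauss t b)) x y)
  · filter_upwards [self_mem_nhdsWithin] with t ht
    exact lengthDist_symGauss_le ht x y
end

section
/- Let η(y) = (4π)^{-1/2} exp(−y²/4). Then the function R(r) := ½ ∫_ℝ (η(y−r) − η(y+r))²/(η(y−r) + η(y+r)) dy satisfies R(r)/r² → 1/2 as r → 0⁺, i.e. R(r) = r²/2 + o(r²). -/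
open MeasureTheory

/-- The one-dimensional Gaussian density with variance 2 (heat kernel at time 1). -/
noncomputable def η (y : ℝ) : ℝ := (Real.sqrt (4 * Real.pi))⁻¹ * Real.exp (-y ^ 2 / 4)

/-- The radial coefficient of the Gigli–Mantegazza metric tensor on the cone `C(π)` at
time 1, at distance `r` from the apex. -/
noncomputable def Rcoeff (r : ℝ) : ℝ :=
  2⁻¹ * ∫ y : ℝ, (η (y - r) - η (y + r)) ^ 2 / (η (y - r) + η (y + r))

lemma η_pos (y : ℝ) : 0 < η y := by
  unfold η; positivity

lemma η_sub_eq (r y : ℝ) :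
    η (y - r) = η y * Real.exp (-r ^ 2 / 4) * Real.exp (y * r / 2) := by
  unfold η
  rw [mul_assoc, mul_assoc, ← Real.exp_add, ← Real.exp_add]
  ring_nf

lemma η_add_eq (r y : ℝ) :
    η (y + r) = η y * Real.exp (-r ^ 2 / 4) * Real.exp (-(y * r / 2)) := by
  unfold η
  rw [mul_assoc, mul_assoc, ← Real.exp_add, ← Real.exp_add]
  ring_nf

lemma integrand_eq (r y : ℝ) :
    (η (y - r) - η (y + r)) ^ 2 / (η (y - r) + η (y + r)) =
      2 * (η y * Real.exp (-r ^ 2 / 4)) * (Real.sinh (y * r / 2) ^ 2 / Real.cosh (y * r / 2)) := by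
  have hη := η_pos y
  rw [η_sub_eq, η_add_eq, Real.sinh_eq, Real.cosh_eq]
  field_simp

lemma continuous_η : Continuous η := by
  unfold η; fun_prop

lemma abs_sinh_le_abs_mul_cosh (u : ℝ) : |Real.sinh u| ≤ |u| * Real.cosh u := by
  have key : ∀ x : ℝ, 0 ≤ x → Real.sinh x ≤ x * Real.cosh x := by
    have hd : ∀ x : ℝ, HasDerivAt (fun x => x * Real.cosh x - Real.sinh x)
        (x * Real.sinh x) x := fun x => by
      have h := ((hasDerivAt_id' x).mul (Real.hasDerivAt_cosh x)).sub (Real.hasDerivAt_sinh x)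
      rwa [one_mul, add_sub_cancel_left] at h
    have hm : MonotoneOn (fun x => x * Real.cosh x - Real.sinh x) (Set.Ici 0) := by
      refine monotoneOn_of_deriv_nonneg (convex_Ici 0) (by fun_prop)
        (fun x _ => (hd x).differentiableAt.differentiableWithinAt) fun x hx => ?_
      rw [interior_Ici] at hx
      rw [(hd x).deriv]
      exact mul_nonneg (le_of_lt hx) (Real.sinh_nonneg_iff.2 (le_of_lt hx))
    intro x hx
    have := hm (Set.mem_Ici.2 le_rfl) (Set.mem_Ici.2 hx) hx
    simp at this
    exact this
  rw [Real.abs_sinh, ← Real.cosh_abs u]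
  exact key _ (abs_nonneg u)

lemma sinh_sq_div_cosh_le (u : ℝ) :
    Real.sinh u ^ 2 / Real.cosh u ≤ u ^ 2 * Real.exp (u ^ 2 / 2) := by
  have hc := Real.cosh_pos u
  have h := pow_le_pow_left₀ (abs_nonneg _) (abs_sinh_le_abs_mul_cosh u) 2
  rw [mul_pow, sq_abs, sq_abs] at h
  calc Real.sinh u ^ 2 / Real.cosh u ≤ u ^ 2 * Real.cosh u := by
        rw [div_le_iff₀ hc]; linarith
    _ ≤ _ := by gcongr; exact Real.cosh_le_exp_half_sq u

lemma tendsto_sinh_mul_div (a : ℝ) :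
    Filter.Tendsto (fun r : ℝ => Real.sinh (a * r) / r) (nhdsWithin 0 (Set.Ioi 0)) (nhds a) := by
  have h : HasDerivAt (fun r : ℝ => Real.sinh (a * r)) a 0 := by
    have := ((hasDerivAt_id (0 : ℝ)).const_mul a).sinh
    simpa using this
  have := h.tendsto_slope_zero_right
  simpa [div_eq_inv_mul] using this

lemma integral_sq_mul_η : ∫ y : ℝ, y ^ 2 * η y = 2 := by
  have h := ProbabilityTheory.variance_id_gaussianReal (μ := 0) (v := 2)
  rw [ProbabilityTheory.variance_of_integral_eq_zero aemeasurable_id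
    (by simp),
    ProbabilityTheory.integral_gaussianReal_eq_integral_smul (by norm_num)] at h
  rw [show (2 : ℝ) = ((2 : NNReal) : ℝ) by norm_num, ← h]
  refine integral_congr_ae (Filter.Eventually.of_forall fun y => ?_)
  simp only [η, ProbabilityTheory.gaussianPDFReal, smul_eq_mul, id, NNReal.coe_ofNat, sub_zero]
  rw [mul_comm]
  congr 3 <;> ring_nf

/-- the asymptotics `R(r) = r²/2 + o(r²)` as `r → 0⁺`. -/
theorem stmt13 :
    Filter.Tendsto (fun r : ℝ => Rcoeff r / r ^ 2)
      (nhdsWithin 0 (Set.Ioi 0)) (nhds (1 / 2)) := by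
  have hR : ∀ r : ℝ, Rcoeff r / r ^ 2 = ∫ y : ℝ, η y * Real.exp (-r ^ 2 / 4) *
      ((Real.sinh (y / 2 * r) / r) ^ 2 / Real.cosh (y / 2 * r)) := fun r => by
    unfold Rcoeff
    rw [← integral_const_mul, ← integral_div]
    congr 1 with y
    rw [integrand_eq, show y * r / 2 = y / 2 * r by ring]
    ring
  have hlim : (1 / 2 : ℝ) = ∫ y : ℝ, η y * (y / 2) ^ 2 := by
    have : ∀ y : ℝ, η y * (y / 2) ^ 2 = 4⁻¹ * (y ^ 2 * η y) := fun y => by ring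
    simp_rw [this, integral_const_mul, integral_sq_mul_η]
    norm_num
  simp_rw [hR, hlim]
  refine tendsto_integral_filter_of_dominated_convergence
    (fun y => (Real.sqrt (4 * Real.pi))⁻¹ / 4 * (y ^ (2 : ℝ) * Real.exp (-(1 / 8) * y ^ 2))) ?_ ?_ ?_ ?_
  · refine Filter.Eventually.of_forall fun r => Continuous.aestronglyMeasurable ?_
    have := continuous_η
    exact (this.mul continuous_const).mul (Continuous.div₀ (by fun_prop) (by fun_prop)
      fun y => (Real.cosh_pos _).ne')
  · filter_upwards [Ioo_mem_nhdsGT (zero_lt_one' ℝ)] with r hr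
    refine Filter.Eventually.of_forall fun y => ?_
    have hη := η_pos y
    have hc := Real.cosh_pos (y / 2 * r)
    have hr0 := hr.1
    have hr2 : r ^ 2 ≤ 1 := pow_le_one₀ hr.1.le hr.2.le
    rw [Real.norm_of_nonneg (by positivity), div_pow, div_right_comm]
    calc η y * Real.exp (-r ^ 2 / 4) * (Real.sinh (y / 2 * r) ^ 2 / Real.cosh (y / 2 * r) / r ^ 2)
        ≤ η y * 1 * (((y / 2 * r) ^ 2 * Real.exp ((y / 2 * r) ^ 2 / 2)) / r ^ 2) := by
          gcongr
          · exact Real.exp_le_one_iff.2 (by nlinarith)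
          · exact sinh_sq_div_cosh_le _
      _ = η y * (y / 2) ^ 2 * Real.exp ((y / 2 * r) ^ 2 / 2) := by field_simp
      _ ≤ η y * (y / 2) ^ 2 * Real.exp (y ^ 2 / 8) := by
          have : (y / 2 * r) ^ 2 / 2 ≤ y ^ 2 / 8 := by
            nlinarith [mul_le_mul_of_nonneg_left hr2 (sq_nonneg y)]
          gcongr
      _ = _ := by
          have he : Real.exp (-(1 / 8) * y ^ 2) = Real.exp (-y ^ 2 / 4) * Real.exp (y ^ 2 / 8) := by
            rw [← Real.exp_add]; ring_nf
          rw [he, η, Real.rpow_two]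
          ring
  · exact (integrable_rpow_mul_exp_neg_mul_sq (by norm_num) (by norm_num)).const_mul _
  · refine Filter.Eventually.of_forall fun y => ?_
    have hcont {f : ℝ → ℝ} (hf : Continuous f) :
        Filter.Tendsto f (nhdsWithin 0 (Set.Ioi 0)) (nhds (f 0)) :=
      (hf.tendsto 0).mono_left nhdsWithin_le_nhds
    have h1 := hcont (f := fun r => η y * Real.exp (-r ^ 2 / 4)) (by fun_prop)
    have h2 := hcont (f := fun r => Real.cosh (y / 2 * r)) (by fun_prop)
    have h3 := h1.mul (((tendsto_sinh_mul_div (y / 2)).pow 2).div h2 (Real.cosh_pos _).ne')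
    simpa using h3
end

section
/- On ℝ² define d̃₁(x,y) := W_c(μ_x^1, μ_y^1) and let d₁ be the induced length distance. For r > 0 set ρ(r) := d₁(0, (r,0)) (the d₁-distance from the apex of C(π) to a point at cone-distance r) and ℓ(r) := the d̃₁-length of the curve [0,π] ∋ s ↦ r(cos s, sin s), i.e. the supremum over partitions 0 = s₀ < ⋯ < s_N = π of Σᵢ d̃₁(r(cos sᵢ, sin sᵢ), r(cos sᵢ₊₁, sin sᵢ₊₁)) (the length of the circle of radius r around the apex, which closes up in the quotient C(π)). Then lim_{r→0⁺} ℓ(r)/ρ(r) = √2·π; i.e. for the Gigli–Mantegazza distance d₁, the cone C(π) has a conic singularity of angle √2·π at the apex. -/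
open MeasureTheory ENNReal

/-- The point `(a, b)` of `ℝ²`. -/
noncomputable def vec2 (a b : ℝ) : EuclideanSpace ℝ (Fin 2) :=
  (WithLp.equiv 2 (Fin 2 → ℝ)).symm ![a, b]

/-- The Gigli–Mantegazza chord distance at time 1 on (the lift of) the cone `C(π)`. -/
noncomputable def dtilde1 (x y : EuclideanSpace ℝ (Fin 2)) : ℝ :=
  W2 coneCost (symGauss 1 x) (symGauss 1 y)

/-- The `d₁`-distance from the apex of `C(π)` to a point at cone-distance `r`. -/
noncomputable def rho1 (r : ℝ) : ℝ≥0∞ :=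
  lengthDist dtilde1 0 (vec2 r 0)

/-- The `d̃₁`-length of the circle of radius `r` around the apex of `C(π)` (the curve
`s ∈ [0,1] ↦ r(cos πs, sin πs)`, which closes up in the quotient). -/
noncomputable def ell1 (r : ℝ) : ℝ≥0∞ :=
  curveLength dtilde1 fun s => vec2 (r * Real.cos (Real.pi * s)) (r * Real.sin (Real.pi * s))

namespace ConeHeat

lemma hasDerivAt_tanh (x : ℝ) : HasDerivAt Real.tanh (1 / Real.cosh x ^ 2) x := by
  have h := (Real.hasDerivAt_sinh x).div (Real.hasDerivAt_cosh x) (Real.cosh_pos x).ne'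
  have e : Real.tanh = Real.sinh / Real.cosh := by
    ext y; simp [Real.tanh_eq_sinh_div_cosh]
  rw [e]
  have h2 : Real.cosh x * Real.cosh x - Real.sinh x * Real.sinh x = 1 := by
    linarith [Real.cosh_sq x]
  rwa [h2] at h

lemma tanh_monotone : Monotone Real.tanh :=
  monotone_of_deriv_nonneg (fun x => (hasDerivAt_tanh x).differentiableAt) fun x => by
    rw [(hasDerivAt_tanh x).deriv]; positivity

lemma tanh_sub_le {a b : ℝ} (h : a ≤ b) : Real.tanh b - Real.tanh a ≤ b - a := by
  have hd : ∀ x, HasDerivAt (fun y => y - Real.tanh y) (1 - 1 / Real.cosh x ^ 2) x :=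
    fun x => (hasDerivAt_id x).sub (hasDerivAt_tanh x)
  have hm : Monotone fun y => y - Real.tanh y :=
    monotone_of_deriv_nonneg (fun x => (hd x).differentiableAt) fun x => by
      rw [(hd x).deriv, sub_nonneg, div_le_one (by positivity)]
      nlinarith [Real.one_le_cosh x]
  have := hm h
  simp only at this
  linarith

lemma abs_tanh_sub_le (a b : ℝ) : |Real.tanh a - Real.tanh b| ≤ |a - b| := by
  rcases le_total a b with h | h
  · rw [abs_sub_comm, abs_sub_comm a b, abs_of_nonneg (sub_nonneg.2 h),
      abs_of_nonneg (sub_nonneg.2 (tanh_monotone h))]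
    exact tanh_sub_le h
  · rw [abs_of_nonneg (sub_nonneg.2 h), abs_of_nonneg (sub_nonneg.2 (tanh_monotone h))]
    exact tanh_sub_le h

lemma abs_tanh_le_abs (a : ℝ) : |Real.tanh a| ≤ |a| := by
  simpa using abs_tanh_sub_le a 0

lemma abs_tanh_le_one (a : ℝ) : |Real.tanh a| ≤ 1 := by
  rw [Real.tanh_eq_sinh_div_cosh, abs_div, abs_of_pos (Real.cosh_pos a),
    div_le_one (Real.cosh_pos a)]
  refine abs_le_of_sq_le_sq ?_ (Real.cosh_pos a).le
  linarith [Real.cosh_sq a]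

/-- `T t` is, for `t ∈ [0, 1]`, the flow of the time-dependent velocity field `tanh (t x / 2)`
on the line. -/
def IsTanhFlow (T : ℝ → ℝ → ℝ) : Prop :=
  ∀ u, T 0 u = u ∧ ∀ t ∈ Set.Icc (0 : ℝ) 1,
    HasDerivWithinAt (fun s => T s u) (Real.tanh (t * T t u / 2)) (Set.Icc 0 1) t

lemma exists_isTanhFlow : ∃ T, IsTanhFlow T := by
  have key : ∀ u : ℝ, ∃ α : ℝ → ℝ, α 0 = u ∧ ∀ t ∈ Set.Icc (0 : ℝ) 1,
      HasDerivWithinAt α (Real.tanh (t * α t / 2)) (Set.Icc 0 1) t := by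
    intro u
    have hpl : IsPicardLindelof (fun t x => Real.tanh (t * x / 2))
        (⟨0, by simp⟩ : Set.Icc (0 : ℝ) 1) u 1 0 1 1 :=
      { lipschitzOnWith := by
          intro t ht
          refine LipschitzOnWith.of_dist_le_mul fun x _ y _ => ?_
          rw [Real.dist_eq, Real.dist_eq]
          refine (abs_tanh_sub_le _ _).trans ?_
          rw [show t * x / 2 - t * y / 2 = t / 2 * (x - y) by ring, abs_mul]
          refine mul_le_mul_of_nonneg_right ?_ (abs_nonneg _)
          rw [abs_of_nonneg (by linarith [ht.1])]
          simpa using by linarith [ht.2]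
        continuousOn := by
          intro x _
          have : Continuous Real.tanh :=
            continuous_iff_continuousAt.2 fun x => (hasDerivAt_tanh x).continuousAt
          exact (this.comp (by fun_prop : Continuous fun t : ℝ => t * x / 2)).continuousOn
        norm_le := by
          intro t _ x _
          simpa using abs_tanh_le_one _
        mul_max_le := by simp }
    exact hpl.exists_eq_forall_mem_Icc_hasDerivWithinAt₀
  choose α hα using key
  exact ⟨fun t u => α u t, hα⟩

open ProbabilityTheory in
/-- The primitive of the centred Gaussian density of variance `2` vanishing at the origin. -/
noncomputable def gaussPrim (x : ℝ) : ℝ := ∫ y in (0 : ℝ)..x, gaussianPDFReal 0 2 y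

open ProbabilityTheory in
lemma continuous_pdf : Continuous (gaussianPDFReal 0 2) := by
  rw [gaussianPDFReal_def]; fun_prop

open ProbabilityTheory in
lemma hasDerivAt_gaussPrim (x : ℝ) : HasDerivAt gaussPrim (gaussianPDFReal 0 2 x) x :=
  intervalIntegral.integral_hasDerivAt_right (continuous_pdf.intervalIntegrable _ _)
    (continuous_pdf.stronglyMeasurableAtFilter _ _) continuous_pdf.continuousAt

lemma gaussPrim_strictMono : StrictMono gaussPrim :=
  strictMono_of_deriv_pos fun x => by
    rw [(hasDerivAt_gaussPrim x).deriv]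
    exact ProbabilityTheory.gaussianPDFReal_pos _ _ _ (by norm_num)

lemma gaussPrim_neg (x : ℝ) : gaussPrim (-x) = -gaussPrim x := by
  have h : ∀ y, ProbabilityTheory.gaussianPDFReal 0 2 (-y) =
      ProbabilityTheory.gaussianPDFReal 0 2 y := fun y => by
    simp [ProbabilityTheory.gaussianPDFReal_def]
  have := intervalIntegral.integral_comp_neg (a := 0) (b := x)
    (ProbabilityTheory.gaussianPDFReal 0 2)
  simp only [h, neg_zero] at this
  rw [gaussPrim, gaussPrim, this, intervalIntegral.integral_symm]
  
/-- The distribution function, centred at the origin, of the mixture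
`½ (N(t, 2) + N(-t, 2))`. -/
noncomputable def mixPrim (t x : ℝ) : ℝ := (gaussPrim (x - t) + gaussPrim (x + t)) / 2

lemma mixPrim_strictMono (t : ℝ) : StrictMono (mixPrim t) := by
  intro x y h
  have h1 := gaussPrim_strictMono (sub_lt_sub_right h t)
  have h2 := gaussPrim_strictMono (add_lt_add_left h t)
  unfold mixPrim
  linarith

lemma mixPrim_zero_right (t : ℝ) : mixPrim t 0 = 0 := by
  simp [mixPrim, gaussPrim_neg]

lemma mixPrim_zero_left (x : ℝ) : mixPrim 0 x = gaussPrim x := by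
  simp [mixPrim]

lemma pdf_mul_tanh (t x : ℝ) :
    ProbabilityTheory.gaussianPDFReal 0 2 (x - t) * (Real.tanh (t * x / 2) - 1) +
      ProbabilityTheory.gaussianPDFReal 0 2 (x + t) * (Real.tanh (t * x / 2) + 1) = 0 := by
  have h1 : Real.exp (-(x - t - 0) ^ 2 / (2 * 2)) =
      Real.exp (-(x ^ 2 + t ^ 2) / 4) * Real.exp (t * x / 2) := by
    rw [← Real.exp_add]; congr 1; ring
  have h2 : Real.exp (-(x + t - 0) ^ 2 / (2 * 2)) =
      Real.exp (-(x ^ 2 + t ^ 2) / 4) * Real.exp (-(t * x / 2)) := by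
    rw [← Real.exp_add]; congr 1; ring
  simp only [ProbabilityTheory.gaussianPDFReal_def, NNReal.coe_ofNat, h1, h2]
  have hc := Real.cosh_pos (t * x / 2)
  rw [Real.tanh_eq_sinh_div_cosh]
  have h3 : Real.exp (t * x / 2) = Real.cosh (t * x / 2) + Real.sinh (t * x / 2) :=
    (Real.cosh_add_sinh _).symm
  have h4 : Real.exp (-(t * x / 2)) = Real.cosh (t * x / 2) - Real.sinh (t * x / 2) :=
    (Real.cosh_sub_sinh _).symm
  rw [h3, h4]
  field_simp
  ring

namespace IsTanhFlow

variable {T : ℝ → ℝ → ℝ}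

lemma continuousOn (hT : IsTanhFlow T) (u : ℝ) : ContinuousOn (fun s => T s u) (Set.Icc 0 1) :=
  fun t ht => ((hT u).2 t ht).continuousWithinAt

lemma hasDerivAt (hT : IsTanhFlow T) (u : ℝ) {t : ℝ} (ht : t ∈ interior (Set.Icc (0 : ℝ) 1)) :
    HasDerivAt (fun s => T s u) (Real.tanh (t * T t u / 2)) t :=
  ((hT u).2 t (interior_subset ht)).hasDerivAt (mem_interior_iff_mem_nhds.1 ht)

lemma mixPrim_eq (hT : IsTanhFlow T) (u : ℝ) {t : ℝ} (ht : t ∈ Set.Icc (0 : ℝ) 1) :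
    mixPrim t (T t u) = gaussPrim u := by
  have hd : ∀ s ∈ Set.Icc (0 : ℝ) 1,
      HasDerivWithinAt (fun s => mixPrim s (T s u)) 0 (Set.Icc 0 1) s := by
    intro s hs
    have h := (hT u).2 s hs
    have h1 := (hasDerivAt_gaussPrim (T s u - s)).comp_hasDerivWithinAt
      (h₂ := gaussPrim) (h := fun s => T s u - s) s (h.sub (hasDerivWithinAt_id s _))
    have h2 := (hasDerivAt_gaussPrim (T s u + s)).comp_hasDerivWithinAt
      (h₂ := gaussPrim) (h := fun s => T s u + s) s (h.add (hasDerivWithinAt_id s _))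
    have h3 := (h1.add h2).div_const 2
    rw [pdf_mul_tanh s (T s u), zero_div] at h3
    exact h3
  have := (convex_Icc (0 : ℝ) 1).is_const_of_fderivWithin_eq_zero (𝕜 := ℝ)
    (f := fun s => mixPrim s (T s u)) (fun s hs => (hd s hs).differentiableWithinAt)
    (fun s hs => by
      ext
      rw [fderivWithin_derivWithin, (hd s hs).derivWithin (uniqueDiffOn_Icc one_pos s hs)]
      simp) ht
      (Set.left_mem_Icc.2 zero_le_one)
  simpa [mixPrim_zero_left, (hT u).1] using this

lemma strictMono (hT : IsTanhFlow T) {t : ℝ} (ht : t ∈ Set.Icc (0 : ℝ) 1) : StrictMono (T t) := by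
  intro u v h
  rw [← (mixPrim_strictMono t).lt_iff_lt, hT.mixPrim_eq u ht, hT.mixPrim_eq v ht]
  exact gaussPrim_strictMono h

lemma apply_zero (hT : IsTanhFlow T) {t : ℝ} (ht : t ∈ Set.Icc (0 : ℝ) 1) : T t 0 = 0 :=
  (mixPrim_strictMono t).injective <| by
    rw [hT.mixPrim_eq 0 ht, mixPrim_zero_right]; simp [gaussPrim]

lemma sub_le_sub (hT : IsTanhFlow T) {t : ℝ} (ht : t ∈ Set.Icc (0 : ℝ) 1) {u v : ℝ} (h : u ≤ v) :
    v - u ≤ T t v - T t u := by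
  have hm : MonotoneOn (fun s => T s v - T s u) (Set.Icc 0 1) := by
    refine monotoneOn_of_hasDerivWithinAt_nonneg (convex_Icc 0 1)
      ((hT.continuousOn v).sub (hT.continuousOn u))
      (fun s hs => ((hT.hasDerivAt v hs).sub (hT.hasDerivAt u hs)).hasDerivWithinAt) ?_
    intro s hs
    have hs' := interior_subset hs
    refine sub_nonneg.2 (tanh_monotone ?_)
    have := (hT.strictMono hs').monotone h
    have := mul_le_mul_of_nonneg_left this hs'.1
    linarith
  have := hm (Set.left_mem_Icc.2 zero_le_one) ht ht.1
  simpa [(hT u).1, (hT v).1] using this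

lemma sub_le_exp_mul (hT : IsTanhFlow T) {t : ℝ} (ht : t ∈ Set.Icc (0 : ℝ) 1)
    {u v : ℝ} (h : u ≤ v) :
    T t v - T t u ≤ Real.exp (t ^ 2 / 4) * (v - u) := by
  have hm : AntitoneOn (fun s => Real.exp (-(s ^ 2 / 4)) * (T s v - T s u)) (Set.Icc 0 1) := by
    refine antitoneOn_of_hasDerivWithinAt_nonpos (convex_Icc 0 1)
      ((by fun_prop : Continuous fun s : ℝ => Real.exp (-(s ^ 2 / 4))).continuousOn.mul
        ((hT.continuousOn v).sub (hT.continuousOn u)))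
      (fun s hs => (HasDerivAt.mul (((hasDerivAt_pow 2 s).div_const 4).neg.exp)
        ((hT.hasDerivAt v hs).sub (hT.hasDerivAt u hs))).hasDerivWithinAt) ?_
    intro s hs
    have hs' := interior_subset hs
    have hmono := mul_le_mul_of_nonneg_left ((hT.strictMono hs').monotone h) hs'.1
    have := tanh_sub_le (show s * T s u / 2 ≤ s * T s v / 2 by linarith)
    have he := Real.exp_pos (-(s ^ 2 / 4))
    have : Real.exp (-(s ^ 2 / 4)) * (Real.tanh (s * T s v / 2) - Real.tanh (s * T s u / 2) -
      (s * T s v / 2 - s * T s u / 2)) ≤ 0 := mul_nonpos_of_nonneg_of_nonpos he.le (by linarith)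
    norm_num
    linarith
  have := hm (Set.left_mem_Icc.2 zero_le_one) ht ht.1
  simp only [(hT u).1, (hT v).1, Real.exp_neg] at this
  rw [← div_eq_inv_mul, div_le_iff₀ (Real.exp_pos _)] at this
  simpa [mul_comm] using this

lemma abs_le (hT : IsTanhFlow T) {t : ℝ} (ht : t ∈ Set.Icc (0 : ℝ) 1) (u : ℝ) :
    |T t u| ≤ Real.exp (t ^ 2 / 4) * |u| := by
  rcases le_total 0 u with h | h
  · have h1 := hT.sub_le_sub ht h
    have h2 := hT.sub_le_exp_mul ht h
    rw [hT.apply_zero ht] at h1 h2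
    rw [abs_of_nonneg h, abs_of_nonneg (by linarith)]
    linarith
  · have h1 := hT.sub_le_sub ht h
    have h2 := hT.sub_le_exp_mul ht h
    rw [hT.apply_zero ht] at h1 h2
    rw [abs_of_nonpos h, abs_of_nonpos (by linarith)]
    linarith

lemma abs_sub_le (hT : IsTanhFlow T) {r s t : ℝ} (hs : 0 ≤ s) (hst : s ≤ t)
    (htr : t ≤ r) (hr : r ≤ 1) (u : ℝ) :
    |T t u - T s u| ≤ Real.exp (r ^ 2 / 4) * |u| * ((t ^ 2 - s ^ 2) / 4) := by
  have hsub : Set.Icc 0 r ⊆ Set.Icc (0 : ℝ) 1 := Set.Icc_subset_Icc le_rfl hr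
  have hbd : ∀ x ∈ interior (Set.Icc 0 r), |Real.tanh (x * T x u / 2)| ≤
      Real.exp (r ^ 2 / 4) * |u| * (2 * x / 4) := by
    intro x hx
    have hx' := interior_subset hx
    refine (abs_tanh_le_abs _).trans ?_
    rw [abs_div, abs_mul, abs_of_nonneg hx'.1, abs_two]
    have h1 := hT.abs_le (hsub hx') u
    have h2 : Real.exp (x ^ 2 / 4) * |u| ≤ Real.exp (r ^ 2 / 4) * |u| := by
      gcongr
      exacts [hx'.1, hx'.2]
    nlinarith [mul_le_mul_of_nonneg_left (h1.trans h2) hx'.1]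
  have hc : Continuous fun x : ℝ => Real.exp (r ^ 2 / 4) * |u| * (x ^ 2 / 4) := by fun_prop
  have hd : ∀ x : ℝ, HasDerivAt (fun x : ℝ => Real.exp (r ^ 2 / 4) * |u| * (x ^ 2 / 4))
      (Real.exp (r ^ 2 / 4) * |u| * (2 * x / 4)) x := fun x => by
    simpa using ((hasDerivAt_pow 2 x).div_const 4).const_mul (Real.exp (r ^ 2 / 4) * |u|)
  have hTc := (hT.continuousOn u).mono hsub
  have m1 : MonotoneOn (fun x => Real.exp (r ^ 2 / 4) * |u| * (x ^ 2 / 4) - T x u)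
      (Set.Icc 0 r) :=
    monotoneOn_of_hasDerivWithinAt_nonneg (convex_Icc 0 r) (hc.continuousOn.sub hTc)
      (fun x hx => ((hd x).sub (hT.hasDerivAt u
        (interior_mono hsub hx))).hasDerivWithinAt)
      (fun x hx => by linarith [(_root_.abs_le.1 (hbd x hx)).2])
  have m2 : MonotoneOn (fun x => Real.exp (r ^ 2 / 4) * |u| * (x ^ 2 / 4) + T x u)
      (Set.Icc 0 r) :=
    monotoneOn_of_hasDerivWithinAt_nonneg (convex_Icc 0 r) (hc.continuousOn.add hTc)
      (fun x hx => ((hd x).add (hT.hasDerivAt u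
        (interior_mono hsub hx))).hasDerivWithinAt)
      (fun x hx => by linarith [(_root_.abs_le.1 (hbd x hx)).1])
  have ms : s ∈ Set.Icc 0 r := ⟨hs, hst.trans htr⟩
  have mt : t ∈ Set.Icc 0 r := ⟨hs.trans hst, htr⟩
  have h1 := m1 ms mt hst
  have h2 := m2 ms mt hst
  simp only at h1 h2
  rw [_root_.abs_le]
  constructor <;> nlinarith

lemma continuous (hT : IsTanhFlow T) {t : ℝ} (ht : t ∈ Set.Icc (0 : ℝ) 1) : Continuous (T t) := by
  refine (LipschitzWith.of_dist_le' (K := Real.exp (t ^ 2 / 4)) fun u v => ?_).continuous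
  rw [Real.dist_eq, Real.dist_eq]
  rcases le_total u v with h | h
  · rw [abs_sub_comm, abs_sub_comm u, abs_of_nonneg (sub_nonneg.2 h),
      abs_of_nonneg (sub_nonneg.2 ((hT.strictMono ht).monotone h))]
    exact hT.sub_le_exp_mul ht h
  · rw [abs_of_nonneg (sub_nonneg.2 h),
      abs_of_nonneg (sub_nonneg.2 ((hT.strictMono ht).monotone h))]
    exact hT.sub_le_exp_mul ht h

lemma surjective (hT : IsTanhFlow T) {t : ℝ} (ht : t ∈ Set.Icc (0 : ℝ) 1)
    : Function.Surjective (T t) := by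
  refine (hT.continuous ht).surjective ?_ ?_
  · refine Filter.tendsto_atTop_mono' _ ?_ Filter.tendsto_id
    filter_upwards [Filter.eventually_ge_atTop 0] with u hu
    simpa [hT.apply_zero ht] using hT.sub_le_sub ht hu
  · refine Filter.tendsto_atBot_mono' _ ?_ Filter.tendsto_id
    filter_upwards [Filter.eventually_le_atBot 0] with u hu
    simpa [hT.apply_zero ht] using hT.sub_le_sub ht hu

end IsTanhFlow

open ProbabilityTheory

lemma gaussianReal_Ioc (m : ℝ) {a b : ℝ} (h : a ≤ b) :
    gaussianReal m 2 (Set.Ioc a b) = ENNReal.ofReal (gaussPrim (b - m) - gaussPrim (a - m)) := by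
  have hp : ∀ x, gaussianPDFReal m 2 x = gaussianPDFReal 0 2 (x - m) := fun x => by
    simp [gaussianPDFReal_sub]
  rw [gaussianReal_apply_eq_integral _ (by norm_num), ← intervalIntegral.integral_of_le h]
  simp_rw [hp]
  rw [intervalIntegral.integral_comp_sub_right, gaussPrim, gaussPrim,
    intervalIntegral.integral_interval_sub_left] <;>
  exact continuous_pdf.intervalIntegrable _ _

lemma IsTanhFlow.map_gaussianReal {T : ℝ → ℝ → ℝ} (hT : IsTanhFlow T) {t : ℝ}
    (ht : t ∈ Set.Icc (0 : ℝ) 1) :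
    (gaussianReal 0 2).map (T t) =
      (2 : ℝ≥0∞)⁻¹ • (gaussianReal t 2 + gaussianReal (-t) 2) := by
  have : IsProbabilityMeasure ((gaussianReal 0 2).map (T t)) :=
    Measure.isProbabilityMeasure_map (hT.continuous ht).aemeasurable
  refine Measure.ext_of_Ioc _ _ fun a b hab => ?_
  obtain ⟨u, rfl⟩ := hT.surjective ht a
  obtain ⟨v, rfl⟩ := hT.surjective ht b
  have huv := (hT.strictMono ht).lt_iff_lt.1 hab
  have hpre : T t ⁻¹' Set.Ioc (T t u) (T t v) = Set.Ioc u v := by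
    ext x
    simp [(hT.strictMono ht).lt_iff_lt, (hT.strictMono ht).le_iff_le]
  rw [Measure.map_apply (hT.continuous ht).measurable measurableSet_Ioc, hpre]
  simp only [Measure.smul_apply, Measure.add_apply, gaussianReal_Ioc _ hab.le,
    gaussianReal_Ioc _ huv.le, smul_eq_mul, sub_zero, sub_neg_eq_add]
  rw [← hT.mixPrim_eq u ht, ← hT.mixPrim_eq v ht, ← ENNReal.ofReal_add,
    show (2 : ℝ≥0∞)⁻¹ = ENNReal.ofReal (2⁻¹) by
      rw [ENNReal.ofReal_inv_of_pos two_pos, ENNReal.ofReal_ofNat],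
    ← ENNReal.ofReal_mul (by norm_num)]
  · congr 1
    simp only [mixPrim]
    ring
  · exact sub_nonneg.2 (gaussPrim_strictMono.monotone (by linarith))
  · exact sub_nonneg.2 (gaussPrim_strictMono.monotone (by linarith))

/-- The coordinates of the plane in an orthonormal basis, as a measurable equivalence with
`ℝ × ℝ`. -/
noncomputable def coords (b : OrthonormalBasis (Fin 2) ℝ (EuclideanSpace ℝ (Fin 2))) :
    EuclideanSpace ℝ (Fin 2) ≃ᵐ ℝ × ℝ :=
  (b.measurableEquiv.trans (MeasurableEquiv.toLp 2 (Fin 2 → ℝ)).symm).trans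
    MeasurableEquiv.finTwoArrow

variable (b : OrthonormalBasis (Fin 2) ℝ (EuclideanSpace ℝ (Fin 2)))

lemma measurePreserving_coords : MeasurePreserving (coords b) :=
  ((volume_preserving_finTwoArrow ℝ).comp
    (EuclideanSpace.volume_preserving_symm_measurableEquiv_toLp (Fin 2))).comp
    b.measurePreserving_measurableEquiv

lemma coords_apply (y : EuclideanSpace ℝ (Fin 2)) :
    coords b y = (inner ℝ (b 0) y, inner ℝ (b 1) y) := by
  rw [← b.repr_apply_apply, ← b.repr_apply_apply]
  rfl

lemma map_coords_gauss2 (x : EuclideanSpace ℝ (Fin 2)) :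
    (gauss2 1 x).map (coords b) =
      (gaussianReal (inner ℝ (b 0) x) 2).prod (gaussianReal (inner ℝ (b 1) x) 2) := by
  rw [gaussianReal_of_var_ne_zero _ (by norm_num), gaussianReal_of_var_ne_zero _ (by norm_num),
    prod_withDensity (measurable_gaussianPDF _ _) (measurable_gaussianPDF _ _)]
  ext s hs
  rw [Measure.map_apply (coords b).measurable hs, gauss2,
    withDensity_apply _ ((coords b).measurable hs), withDensity_apply _ hs,
    ← Measure.volume_eq_prod,
    ← (measurePreserving_coords b).setLIntegral_comp_preimage_emb
      (coords b).measurableEmbedding]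
  refine lintegral_congr fun y => ?_
  rw [coords_apply, gaussianPDF, gaussianPDF, ← ENNReal.ofReal_mul (gaussianPDFReal_nonneg _ _ _)]
  congr 1
  have hn : ‖y - x‖ ^ 2 = (inner ℝ (b 0) y - inner ℝ (b 0) x) ^ 2 +
      (inner ℝ (b 1) y - inner ℝ (b 1) x) ^ 2 := by
    rw [← b.sum_sq_norm_inner_right, Fin.sum_univ_two]
    simp [inner_sub_right]
  simp only [gaussianPDFReal_def, hn, NNReal.coe_ofNat]
  rw [mul_mul_mul_comm, ← Real.exp_add, ← mul_inv, Real.mul_self_sqrt (by positivity)]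
  congr 1
  · ring_nf
  · congr 1
    ring

instance isProbabilityMeasure_gauss2 (x : EuclideanSpace ℝ (Fin 2)) :
    IsProbabilityMeasure (gauss2 1 x) := by
  have h := map_coords_gauss2 (stdOrthonormalBasis ℝ (EuclideanSpace ℝ (Fin 2)) |>.reindex
    (finCongr (by simp))) x
  constructor
  rw [← Set.preimage_univ, ← Measure.map_apply (coords _).measurable MeasurableSet.univ, h]
  exact measure_univ

lemma exists_basis {e : EuclideanSpace ℝ (Fin 2)} (he : ‖e‖ = 1) :
    ∃ b : OrthonormalBasis (Fin 2) ℝ (EuclideanSpace ℝ (Fin 2)), b 0 = e := by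
  obtain ⟨b, hb⟩ := Orthonormal.exists_orthonormalBasis_extension_of_card_eq (𝕜 := ℝ)
    (E := EuclideanSpace ℝ (Fin 2)) (ι := Fin 2) (by simp) (v := fun _ => e) (s := {0})
    ⟨fun i => he, fun i j hij => (hij (Subsingleton.elim _ _)).elim⟩
  exact ⟨b, hb 0 rfl⟩

lemma map_inner_gauss2 {e : EuclideanSpace ℝ (Fin 2)} (he : ‖e‖ = 1)
    (x : EuclideanSpace ℝ (Fin 2)) :
    (gauss2 1 x).map (fun y => inner ℝ e y) = gaussianReal (inner ℝ e x) 2 := by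
  obtain ⟨b, rfl⟩ := exists_basis he
  have h := congrArg (Measure.map Prod.fst) (map_coords_gauss2 b x)
  rw [Measure.map_map measurable_fst (coords b).measurable, Measure.map_fst_prod, measure_univ,
    one_smul] at h
  rw [← h]
  congr 1
  ext y
  simp [coords_apply]

/-- The map of the plane moving the `e`-coordinate by the flow `T` at time `t`. -/
noncomputable def stretch (T : ℝ → ℝ → ℝ) (t : ℝ) (e y : EuclideanSpace ℝ (Fin 2)) :
    EuclideanSpace ℝ (Fin 2) :=
  y + (T t (inner ℝ e y) - inner ℝ e y) • e

lemma symGauss_one (x : EuclideanSpace ℝ (Fin 2)) :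
    symGauss 1 x = (2 : ℝ≥0∞)⁻¹ • (gauss2 1 x + gauss2 1 (-x)) := by
  simp [symGauss]

instance isProbabilityMeasure_symGauss (x : EuclideanSpace ℝ (Fin 2)) :
    IsProbabilityMeasure (symGauss 1 x) := by
  constructor
  rw [symGauss_one]
  simp [ENNReal.inv_two_add_inv_two]

namespace IsTanhFlow

variable {T : ℝ → ℝ → ℝ}

lemma measurable_stretch (hT : IsTanhFlow T) {t : ℝ} (ht : t ∈ Set.Icc (0 : ℝ) 1)
    (e : EuclideanSpace ℝ (Fin 2)) :
    Measurable (stretch T t e) := by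
  have := hT.continuous ht
  unfold stretch
  fun_prop

lemma map_stretch (hT : IsTanhFlow T) {t : ℝ} (ht : t ∈ Set.Icc (0 : ℝ) 1)
    {e : EuclideanSpace ℝ (Fin 2)}
    (he : ‖e‖ = 1) : (gauss2 1 0).map (stretch T t e) = symGauss 1 (t • e) := by
  obtain ⟨b, rfl⟩ := exists_basis he
  have h01 : inner ℝ (b 1) (b 0) = 0 := b.orthonormal.2 (by simp)
  have h00 : inner ℝ (b 0) (b 0) = 1 := by simp
  have hinj : Function.Injective (Measure.map (coords b)) :=
    (coords b).map_measurableEquiv_injective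
  apply hinj
  have hcomp : coords b ∘ stretch T t (b 0) = Prod.map (T t) id ∘ coords b := by
    ext y <;> simp [coords_apply, stretch, inner_add_right, inner_smul_right, h01]
  have hTm := (hT.continuous ht).measurable
  rw [Measure.map_map (coords b).measurable (hT.measurable_stretch ht _), hcomp,
    ← Measure.map_map (hTm.prodMap measurable_id) (coords b).measurable, map_coords_gauss2,
    ← Measure.map_prod_map _ _ hTm measurable_id, inner_zero_right, inner_zero_right,
    hT.map_gaussianReal ht, Measure.map_id, symGauss_one, Measure.map_smul,
    Measure.map_add _ _ (coords b).measurable, map_coords_gauss2, map_coords_gauss2]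
  simp only [inner_neg_right, inner_smul_right, h01, h00, mul_zero, mul_one, neg_zero]
  rw [Measure.prod_smul_left, Measure.add_prod]

end IsTanhFlow

lemma integrable_inner_sq (w x : EuclideanSpace ℝ (Fin 2)) :
    Integrable (fun y => inner ℝ w y ^ 2) (gauss2 1 x) ∧
      ∫ y, inner ℝ w y ^ 2 ∂gauss2 1 x = 2 * ‖w‖ ^ 2 + inner ℝ w x ^ 2 := by
  rcases eq_or_ne w 0 with rfl | hw
  · simp
  obtain ⟨e, he, hwe⟩ : ∃ e : EuclideanSpace ℝ (Fin 2), ‖e‖ = 1 ∧ w = ‖w‖ • e :=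
    ⟨‖w‖⁻¹ • w, by rw [norm_smul, norm_inv, norm_norm, inv_mul_cancel₀ (norm_ne_zero_iff.2 hw)],
      by rw [smul_smul, mul_inv_cancel₀ (norm_ne_zero_iff.2 hw), one_smul]⟩
  have hm : Measurable fun y : EuclideanSpace ℝ (Fin 2) => inner ℝ e y := by fun_prop
  have hf : ∀ y : EuclideanSpace ℝ (Fin 2), inner ℝ w y ^ 2 = ‖w‖ ^ 2 * inner ℝ e y ^ 2 := by
    intro y
    conv_lhs => rw [hwe, inner_smul_left]
    simp [mul_pow]
  have hL := memLp_id_gaussianReal (μ := inner ℝ e x) (v := 2) 2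
  have hi : Integrable (fun y => y ^ 2) (gaussianReal (inner ℝ e x) 2) := hL.integrable_sq
  have hv := variance_id_gaussianReal (μ := inner ℝ e x) (v := 2)
  rw [variance_eq_sub hL] at hv
  have hv' : ∫ y, y ^ 2 ∂gaussianReal (inner ℝ e x) 2 = 2 + inner ℝ e x ^ 2 := by
    simp at hv
    linarith
  rw [← map_inner_gauss2 he] at hi hv'
  rw [integral_map hm.aemeasurable (by fun_prop)] at hv'
  simp_rw [hf]
  refine ⟨(hi.comp_measurable hm).const_mul _, ?_⟩
  rw [integral_const_mul, hv']
  ring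

lemma integrable_inner_sq_symGauss (w x : EuclideanSpace ℝ (Fin 2)) :
    Integrable (fun y => inner ℝ w y ^ 2) (symGauss 1 x) ∧
      ∫ y, inner ℝ w y ^ 2 ∂symGauss 1 x = 2 * ‖w‖ ^ 2 + inner ℝ w x ^ 2 := by
  obtain ⟨h1, h2⟩ := integrable_inner_sq w x
  obtain ⟨h3, h4⟩ := integrable_inner_sq w (-x)
  rw [symGauss_one]
  refine ⟨(h1.add_measure h3).smul_measure (by simp), ?_⟩
  rw [integral_smul_measure, integral_add_measure h1 h3, h2, h4]
  simp
  ring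

lemma symGauss_neg (x : EuclideanSpace ℝ (Fin 2)) : symGauss 1 (-x) = symGauss 1 x := by
  rw [symGauss_one, symGauss_one, neg_neg, add_comm]

lemma coneCost_nonneg (x y : EuclideanSpace ℝ (Fin 2)) : 0 ≤ coneCost x y :=
  le_min (norm_nonneg _) (norm_nonneg _)

lemma dtilde1_le_of_transportCost_le {x y : EuclideanSpace ℝ (Fin 2)} {B : ℝ} (hB : 0 ≤ B)
    (h : transportCost coneCost (symGauss 1 x) (symGauss 1 y) ≤ ENNReal.ofReal (B ^ 2)) :
    dtilde1 x y ≤ B :=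
  Real.sqrt_le_iff.2 ⟨hB, ENNReal.toReal_le_of_le_ofReal (sq_nonneg B) h⟩

lemma transportCost_le {μ ν P : Measure (EuclideanSpace ℝ (Fin 2))}
    {S S' : EuclideanSpace ℝ (Fin 2) → EuclideanSpace ℝ (Fin 2)}
    (hS : Measurable S) (hS' : Measurable S') (hμ : P.map S = μ) (hν : P.map S' = ν)
    {q : EuclideanSpace ℝ (Fin 2) → ℝ} (hq : Integrable q P)
    (hle : ∀ y, ‖S y - S' y‖ ^ 2 ≤ q y) :
    transportCost coneCost μ ν ≤ ENNReal.ofReal (∫ y, q y ∂P) := by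
  have hc : IsCoupling (P.map fun y => (S y, S' y)) μ ν := by
    constructor
    · rw [Measure.map_map measurable_fst (hS.prodMk hS'), ← hμ]; rfl
    · rw [Measure.map_map measurable_snd (hS.prodMk hS'), ← hν]; rfl
  refine (iInf₂_le (P.map fun y => (S y, S' y)) hc).trans ?_
  rw [ofReal_integral_eq_lintegral_ofReal hq
    (Filter.Eventually.of_forall fun y => (sq_nonneg _).trans (hle y))]
  refine (lintegral_map_le _ _).trans (lintegral_mono fun y => ENNReal.ofReal_le_ofReal ?_)
  refine le_trans ?_ (hle y)
  exact pow_le_pow_left₀ (coneCost_nonneg _ _) (min_le_left _ _) 2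

/-- Weak Kantorovich duality: admissible potentials bound the transport cost from below. -/
lemma le_transportCost {μ ν : Measure (EuclideanSpace ℝ (Fin 2))}
    {f g : EuclideanSpace ℝ (Fin 2) → ℝ} (hf : Integrable f μ) (hg : Integrable g ν)
    (hle : ∀ x y, f x - g y ≤ coneCost x y ^ 2) :
    ENNReal.ofReal (∫ x, f x ∂μ - ∫ y, g y ∂ν) ≤ transportCost coneCost μ ν := by
  refine le_iInf₂ fun π hπ => ?_
  obtain ⟨rfl, rfl⟩ := hπ
  have h1 : Integrable (fun p : _ × _ => f p.1) π := hf.comp_measurable measurable_fst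
  have h2 : Integrable (fun p : _ × _ => g p.2) π := hg.comp_measurable measurable_snd
  rw [integral_map measurable_fst.aemeasurable hf.1, integral_map measurable_snd.aemeasurable hg.1,
    ← integral_sub h1 h2]
  refine le_trans ?_ (lintegral_mono fun p => ENNReal.ofReal_le_ofReal (hle p.1 p.2))
  refine ENNReal.ofReal_le_of_le_toReal ?_
  refine (integral_eq_lintegral_pos_part_sub_lintegral_neg_part (h1.sub h2)).trans_le ?_
  exact sub_le_self _ ENNReal.toReal_nonneg

lemma le_dtilde1_of_le_transportCost {x y : EuclideanSpace ℝ (Fin 2)} {w : ℝ}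
    (hfin : transportCost coneCost (symGauss 1 x) (symGauss 1 y) ≠ ⊤)
    (h : ENNReal.ofReal (w ^ 2) ≤ transportCost coneCost (symGauss 1 x) (symGauss 1 y)) :
    w ≤ dtilde1 x y :=
  Real.le_sqrt_of_sq_le ((ENNReal.ofReal_le_iff_le_toReal hfin).1 h)

/-- The pointwise bound behind the duality estimate with the test function
`y ↦ ⟪e, y⟫² - ⟪e', y⟫²`, where `z` is the displacement. -/
lemma quadratic_potential_bound {e e' : EuclideanSpace ℝ (Fin 2)} (he' : ‖e'‖ = 1) {L : ℝ}
    (hL : 0 < L) (x z : EuclideanSpace ℝ (Fin 2)) :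
    (inner ℝ e x ^ 2 - inner ℝ e' x ^ 2) - (inner ℝ e (x - z) ^ 2 - inner ℝ e' (x - z) ^ 2) -
      ‖inner ℝ e x • e - inner ℝ e' x • e'‖ ^ 2 / L ≤ (L + 1) * ‖z‖ ^ 2 := by
  set v := inner ℝ e x • e - inner ℝ e' x • e' with hv
  have hvz : inner ℝ v z = inner ℝ e x * inner ℝ e z - inner ℝ e' x * inner ℝ e' z := by
    simp [hv, inner_sub_left, inner_smul_left]
  have hz : inner ℝ e' z ^ 2 ≤ ‖z‖ ^ 2 := by
    have := abs_real_inner_le_norm e' z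
    rw [he', one_mul] at this
    exact sq_le_sq' (by linarith [abs_le.1 this]) (abs_le.1 this).2
  have hyoung : 2 * inner ℝ v z ≤ ‖v‖ ^ 2 / L + L * ‖z‖ ^ 2 := by
    have h1 := real_inner_le_norm v z
    have h2 : ‖v‖ ^ 2 / L + L * ‖z‖ ^ 2 - 2 * (‖v‖ * ‖z‖) = (‖v‖ - L * ‖z‖) ^ 2 / L := by
      field_simp
      ring
    have h3 : 0 ≤ (‖v‖ - L * ‖z‖) ^ 2 / L := by positivity
    linarith
  simp only [inner_sub_right]
  nlinarith [sq_nonneg (inner ℝ e z)]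

lemma quadratic_potential_bound_coneCost {e e' : EuclideanSpace ℝ (Fin 2)} (he' : ‖e'‖ = 1)
    {L : ℝ} (hL : 0 < L) (x y : EuclideanSpace ℝ (Fin 2)) :
    (inner ℝ e x ^ 2 - inner ℝ e' x ^ 2 -
      ‖inner ℝ e x • e - inner ℝ e' x • e'‖ ^ 2 / L) / (L + 1) -
      (inner ℝ e y ^ 2 - inner ℝ e' y ^ 2) / (L + 1) ≤ coneCost x y ^ 2 := by
  rw [← sub_div, div_le_iff₀ (by linarith), mul_comm (coneCost x y ^ 2), coneCost]
  rcases min_choice ‖x - y‖ ‖x + y‖ with h | h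
  · rw [h]
    have := quadratic_potential_bound (e := e) he' hL x (x - y)
    rw [sub_sub_cancel x y] at this
    linarith
  · rw [h]
    have := quadratic_potential_bound (e := e) he' hL x (x + y)
    rw [sub_add_cancel_left, inner_neg_right, inner_neg_right, neg_sq, neg_sq] at this
    linarith

/-- The duality estimate with an optimized parameter. -/
lemma div_sqrt_le_dtilde1 {x y e e' : EuclideanSpace ℝ (Fin 2)} (he' : ‖e'‖ = 1) {D K : ℝ}
    (hD : 0 < D) (hK : 0 < K)
    (hfin : transportCost coneCost (symGauss 1 x) (symGauss 1 y) ≠ ⊤)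
    (hKi : Integrable (fun p => ‖inner ℝ e p • e - inner ℝ e' p • e'‖ ^ 2) (symGauss 1 x))
    (hKv : ∫ p, ‖inner ℝ e p • e - inner ℝ e' p • e'‖ ^ 2 ∂symGauss 1 x = K)
    (hDv : inner ℝ e x ^ 2 - inner ℝ e' x ^ 2 - (inner ℝ e y ^ 2 - inner ℝ e' y ^ 2) = D) :
    D / √(4 * K + 2 * D) ≤ dtilde1 x y := by
  refine le_dtilde1_of_le_transportCost hfin ?_
  have hL : 0 < 2 * K / D := by positivity
  obtain ⟨i1, v1⟩ := integrable_inner_sq_symGauss e x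
  obtain ⟨i2, v2⟩ := integrable_inner_sq_symGauss e' x
  obtain ⟨i3, v3⟩ := integrable_inner_sq_symGauss e y
  obtain ⟨i4, v4⟩ := integrable_inner_sq_symGauss e' y
  have i5 : Integrable (fun p => inner ℝ e p ^ 2 - inner ℝ e' p ^ 2) (symGauss 1 x) := i1.sub i2
  have i6 : Integrable (fun p => inner ℝ e p ^ 2 - inner ℝ e' p ^ 2) (symGauss 1 y) := i3.sub i4
  have i7 : Integrable (fun p => inner ℝ e p ^ 2 - inner ℝ e' p ^ 2 -
      ‖inner ℝ e p • e - inner ℝ e' p • e'‖ ^ 2 / (2 * K / D)) (symGauss 1 x) :=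
    i5.sub (hKi.div_const _)
  refine le_trans (ENNReal.ofReal_le_ofReal (le_of_eq ?_))
    (le_transportCost (i7.div_const (2 * K / D + 1)) (i6.div_const (2 * K / D + 1))
      (quadratic_potential_bound_coneCost he' hL))
  rw [integral_div, integral_div, integral_sub i5 (hKi.div_const _), integral_sub i3 i4,
    integral_div, hKv, integral_sub i1 i2, v1, v2, v3, v4, ← sub_div, div_pow,
    Real.sq_sqrt (by positivity), ← hDv]
  rw [← hDv] at hD
  field_simp
  ring

section Unit

variable {e e' : EuclideanSpace ℝ (Fin 2)}

lemma inner_sq_le_one (he : ‖e‖ = 1) (he' : ‖e'‖ = 1) : inner ℝ e e' ^ 2 ≤ 1 := by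
  have := abs_real_inner_le_norm e e'
  rw [he, he', one_mul] at this
  exact (sq_le_one_iff_abs_le_one _).2 this

lemma norm_smul_sub_smul_sq (he : ‖e‖ = 1) (he' : ‖e'‖ = 1) (a b : ℝ) :
    ‖a • e - b • e'‖ ^ 2 = (1 - inner ℝ e e') * (a ^ 2 + b ^ 2) + inner ℝ e e' * (a - b) ^ 2 := by
  rw [norm_sub_sq_real, norm_smul, norm_smul, he, he', inner_smul_left, inner_smul_right]
  simp
  ring

lemma norm_sub_sq_unit (he : ‖e‖ = 1) (he' : ‖e'‖ = 1) : ‖e - e'‖ ^ 2 = 2 - 2 * inner ℝ e e' := by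
  rw [norm_sub_sq_real, he, he']
  ring

lemma IsTanhFlow.transportCost_radial_le {T : ℝ → ℝ → ℝ} (hT : IsTanhFlow T) (he : ‖e‖ = 1)
    {r s t : ℝ} (hs : 0 ≤ s) (hst : s ≤ t) (htr : t ≤ r) (hr : r ≤ 1) :
    transportCost coneCost (symGauss 1 (s • e)) (symGauss 1 (t • e)) ≤
      ENNReal.ofReal ((Real.exp (r ^ 2 / 4) * (t ^ 2 - s ^ 2) / √8) ^ 2) ∧
    transportCost coneCost (symGauss 1 (t • e)) (symGauss 1 (s • e)) ≤
      ENNReal.ofReal ((Real.exp (r ^ 2 / 4) * (t ^ 2 - s ^ 2) / √8) ^ 2) := by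
  have ms : s ∈ Set.Icc (0 : ℝ) 1 := ⟨hs, by linarith⟩
  have mt : t ∈ Set.Icc (0 : ℝ) 1 := ⟨by linarith, by linarith⟩
  obtain ⟨hi, hv⟩ := integrable_inner_sq e 0
  have hq := hi.const_mul ((Real.exp (r ^ 2 / 4) * ((t ^ 2 - s ^ 2) / 4)) ^ 2)
  have hval : ∫ y, (Real.exp (r ^ 2 / 4) * ((t ^ 2 - s ^ 2) / 4)) ^ 2 * inner ℝ e y ^ 2
      ∂gauss2 1 0 = (Real.exp (r ^ 2 / 4) * (t ^ 2 - s ^ 2) / √8) ^ 2 := by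
    rw [integral_const_mul, hv, he, inner_zero_right, div_pow, Real.sq_sqrt (by norm_num)]
    ring
  have hle : ∀ y, ‖stretch T t e y - stretch T s e y‖ ^ 2 ≤
      (Real.exp (r ^ 2 / 4) * ((t ^ 2 - s ^ 2) / 4)) ^ 2 * inner ℝ e y ^ 2 := by
    intro y
    have h1 := hT.abs_sub_le hs hst htr hr (inner ℝ e y)
    have h2 : stretch T t e y - stretch T s e y =
        (T t (inner ℝ e y) - T s (inner ℝ e y)) • e := by
      simp only [stretch, sub_smul]; abel
    rw [h2, norm_smul, he, mul_one, Real.norm_eq_abs]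
    refine (pow_le_pow_left₀ (abs_nonneg _) h1 2).trans (le_of_eq ?_)
    rw [mul_pow, mul_pow, mul_pow, sq_abs]
    ring
  rw [← hval]
  exact ⟨transportCost_le (hT.measurable_stretch ms e) (hT.measurable_stretch mt e)
      (hT.map_stretch ms he) (hT.map_stretch mt he) hq fun y => by
        rw [norm_sub_rev]; exact hle y,
    transportCost_le (hT.measurable_stretch mt e) (hT.measurable_stretch ms e)
      (hT.map_stretch mt he) (hT.map_stretch ms he) hq hle⟩

lemma IsTanhFlow.transportCost_angular_le_of_nonneg {T : ℝ → ℝ → ℝ} (hT : IsTanhFlow T)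
    (he : ‖e‖ = 1) (he' : ‖e'‖ = 1) (hc : 0 ≤ inner ℝ e e') {r : ℝ}
    (hr : r ∈ Set.Icc (0 : ℝ) 1) :
    transportCost coneCost (symGauss 1 (r • e)) (symGauss 1 (r • e')) ≤
      ENNReal.ofReal
        ((2 * (Real.exp (r ^ 2 / 4) - 1) * √(1 - inner ℝ e e' ^ 2)) ^ 2) := by
  set L := Real.exp (r ^ 2 / 4) - 1 with hL
  set c : ℝ := inner ℝ e e' with hcdef
  have hc1 : c ≤ 1 := by
    have := real_inner_le_norm e e'
    rwa [he, he', one_mul] at this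
  obtain ⟨i1, v1⟩ := integrable_inner_sq e 0
  obtain ⟨i2, v2⟩ := integrable_inner_sq e' 0
  obtain ⟨i3, v3⟩ := integrable_inner_sq (e - e') 0
  have i4 : Integrable (fun y => (1 - c) * (inner ℝ e y ^ 2 + inner ℝ e' y ^ 2)) (gauss2 1 0) :=
    (i1.add i2).const_mul (1 - c)
  have hq : Integrable (fun y => L ^ 2 * ((1 - c) * (inner ℝ e y ^ 2 + inner ℝ e' y ^ 2) +
      c * inner ℝ (e - e') y ^ 2)) (gauss2 1 0) := (i4.add (i3.const_mul c)).const_mul (L ^ 2)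
  have hval : ∫ y, L ^ 2 * ((1 - c) * (inner ℝ e y ^ 2 + inner ℝ e' y ^ 2) +
      c * inner ℝ (e - e') y ^ 2) ∂gauss2 1 0 = (2 * L * √(1 - c ^ 2)) ^ 2 := by
    rw [integral_const_mul, integral_add i4 (i3.const_mul c),
      integral_const_mul, integral_const_mul, integral_add i1 i2, v1, v2, v3, he, he',
      norm_sub_sq_unit he he', mul_pow, Real.sq_sqrt (by nlinarith)]
    simp only [inner_zero_right]
    ring
  rw [← hval]
  refine transportCost_le (hT.measurable_stretch hr e) (hT.measurable_stretch hr e')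
    (hT.map_stretch hr he) (hT.map_stretch hr he') hq fun y => ?_
  have hdisp : ∀ {u v : ℝ}, u ≤ v → ((T r v - v) - (T r u - u)) ^ 2 ≤ L ^ 2 * (v - u) ^ 2 := by
    intro u v huv
    have h1 := hT.sub_le_sub hr huv
    have h2 := hT.sub_le_exp_mul hr huv
    rw [← mul_pow]
    exact pow_le_pow_left₀ (by linarith) (by rw [hL]; linarith) 2
  have hlip : ∀ u v : ℝ, ((T r u - u) - (T r v - v)) ^ 2 ≤ L ^ 2 * (u - v) ^ 2 := by
    intro u v
    rcases le_total u v with h | h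
    · have := hdisp h
      rw [← neg_sub v u, ← neg_sub (T r v - v), neg_sq, neg_sq]
      exact this
    · exact hdisp h
  have hzero : ∀ u : ℝ, (T r u - u) ^ 2 ≤ L ^ 2 * u ^ 2 := by
    intro u
    simpa [hT.apply_zero hr] using hlip u 0
  have hS : stretch T r e y - stretch T r e' y =
      (T r (inner ℝ e y) - inner ℝ e y) • e - (T r (inner ℝ e' y) - inner ℝ e' y) • e' := by
    simp only [stretch]; abel
  rw [hS, norm_smul_sub_smul_sq he he', inner_sub_left]
  have h1 := mul_le_mul_of_nonneg_left
    (add_le_add (hzero (inner ℝ e y)) (hzero (inner ℝ e' y))) (sub_nonneg.2 hc1)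
  have h2 := mul_le_mul_of_nonneg_left (hlip (inner ℝ e y) (inner ℝ e' y)) hc
  linarith

lemma IsTanhFlow.transportCost_angular_le {T : ℝ → ℝ → ℝ} (hT : IsTanhFlow T)
    (he : ‖e‖ = 1) (he' : ‖e'‖ = 1) {r : ℝ} (hr : r ∈ Set.Icc (0 : ℝ) 1) :
    transportCost coneCost (symGauss 1 (r • e)) (symGauss 1 (r • e')) ≤
      ENNReal.ofReal
        ((2 * (Real.exp (r ^ 2 / 4) - 1) * √(1 - inner ℝ e e' ^ 2)) ^ 2) := by
  rcases le_total 0 (inner ℝ e e' : ℝ) with h | h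
  · exact hT.transportCost_angular_le_of_nonneg he he' h hr
  · have := hT.transportCost_angular_le_of_nonneg he (e' := -e') (by rwa [norm_neg])
      (by rw [inner_neg_right]; linarith) hr
    rwa [smul_neg, symGauss_neg, inner_neg_right, neg_sq] at this

lemma le_dtilde1_radial (he : ‖e‖ = 1) {r : ℝ} (hr : 0 < r) (hr1 : r ≤ 1) :
    r ^ 2 / √(8 + 2 * r ^ 2) ≤ dtilde1 0 (r • e) := by
  obtain ⟨T, hT⟩ := exists_isTanhFlow
  have hn : ∀ p : EuclideanSpace ℝ (Fin 2),
      ‖inner ℝ (0 : EuclideanSpace ℝ (Fin 2)) p • (0 : EuclideanSpace ℝ (Fin 2)) -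
        inner ℝ e p • e‖ ^ 2 = inner ℝ e p ^ 2 := fun p => by
    simp [norm_smul, he]
  obtain ⟨i, v⟩ := integrable_inner_sq_symGauss e 0
  have hfin := ne_top_of_le_ne_top ENNReal.ofReal_ne_top
    (hT.transportCost_radial_le he le_rfl hr.le le_rfl hr1).1
  rw [zero_smul] at hfin
  have := div_sqrt_le_dtilde1 (D := r ^ 2) (K := 2) (e := 0) he (by positivity) two_pos hfin
    (by simpa only [hn] using i) (by simp only [hn, v, he]; simp)
    (by simp [inner_smul_right, he])
  norm_num at this
  exact this

lemma le_dtilde1_angular (he : ‖e‖ = 1) (he' : ‖e'‖ = 1) {r : ℝ} (hr : 0 < r) (hr1 : r ≤ 1) :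
    r ^ 2 / √(4 + 2 * r ^ 2) * √(1 - inner ℝ e e' ^ 2) ≤ dtilde1 (r • e) (r • e') := by
  obtain ⟨T, hT⟩ := exists_isTanhFlow
  set c : ℝ := inner ℝ e e' with hc
  rcases (sub_nonneg.2 (inner_sq_le_one he he')).eq_or_lt with h | h
  · rw [← hc] at h
    rw [← h, Real.sqrt_zero, mul_zero]
    exact Real.sqrt_nonneg _
  rw [← hc] at h
  have hfin := ne_top_of_le_ne_top ENNReal.ofReal_ne_top
    (hT.transportCost_angular_le he he' ⟨hr.le, hr1⟩)
  obtain ⟨i1, v1⟩ := integrable_inner_sq_symGauss e (r • e)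
  obtain ⟨i2, v2⟩ := integrable_inner_sq_symGauss e' (r • e)
  obtain ⟨i3, v3⟩ := integrable_inner_sq_symGauss (e - e') (r • e)
  have i4 : Integrable (fun y => (1 - c) * (inner ℝ e y ^ 2 + inner ℝ e' y ^ 2))
      (symGauss 1 (r • e)) := (i1.add i2).const_mul (1 - c)
  have i5 : Integrable (fun y => (1 - c) * (inner ℝ e y ^ 2 + inner ℝ e' y ^ 2) +
      c * inner ℝ (e - e') y ^ 2) (symGauss 1 (r • e)) := i4.add (i3.const_mul c)
  have hn : ∀ p : EuclideanSpace ℝ (Fin 2), ‖inner ℝ e p • e - inner ℝ e' p • e'‖ ^ 2 =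
      (1 - c) * (inner ℝ e p ^ 2 + inner ℝ e' p ^ 2) + c * inner ℝ (e - e') p ^ 2 := fun p => by
    rw [norm_smul_sub_smul_sq he he', inner_sub_left]
  have hee : inner ℝ e e = (1 : ℝ) := by rw [real_inner_self_eq_norm_sq, he, one_pow]
  have hee' : inner ℝ e' e' = (1 : ℝ) := by rw [real_inner_self_eq_norm_sq, he', one_pow]
  have hce : inner ℝ e' e = c := real_inner_comm _ _
  have := div_sqrt_le_dtilde1 (D := 2 * r ^ 2 * (1 - c ^ 2)) (K := (4 + r ^ 2) * (1 - c ^ 2))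
    (e := e) he' (by positivity) (by positivity) hfin
    (by simpa only [hn] using i5)
    (by
      simp only [hn]
      rw [integral_add i4 (i3.const_mul c), integral_const_mul, integral_const_mul,
        integral_add i1 i2, v1, v2, v3, norm_sub_sq_unit he he', he, he']
      simp only [inner_smul_right, inner_sub_left, hee, hce, ← hc]
      ring)
    (by
      simp only [inner_smul_right, hee, hee', hce, ← hc]
      ring)
  refine le_trans (le_of_eq ?_) this
  rw [show 4 * ((4 + r ^ 2) * (1 - c ^ 2)) + 2 * (2 * r ^ 2 * (1 - c ^ 2)) =
      2 ^ 2 * ((4 + 2 * r ^ 2) * (1 - c ^ 2)) by ring, Real.sqrt_mul (by norm_num),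
    Real.sqrt_sq (by norm_num), Real.sqrt_mul (by positivity)]
  have h1 : √(1 - c ^ 2) ≠ 0 := (Real.sqrt_pos.2 h).ne'
  have h2 : √(4 + 2 * r ^ 2) ≠ 0 := (Real.sqrt_pos.2 (by positivity)).ne'
  field_simp
  rw [Real.sq_sqrt h.le]

end Unit

section Length

variable {Y : Type*} {ρ : Y → Y → ℝ} {γ : ℝ → Y}

lemma le_of_isPartition {N : ℕ} {s : ℕ → ℝ} (h : IsPartition N s) {i j : ℕ} (hij : i ≤ j)
    (hj : j ≤ N) : s i ≤ s j := by
  induction j, hij using Nat.le_induction with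
  | base => exact le_rfl
  | succ k _ ih => exact (ih (by omega)).trans (h.2.2 k (by omega)).le

lemma curveLength_le {F : ℝ → ℝ}
    (hF : ∀ a b, 0 ≤ a → a ≤ b → b ≤ 1 → ρ (γ a) (γ b) ≤ F b - F a) :
    curveLength ρ γ ≤ ENNReal.ofReal (F 1 - F 0) := by
  refine iSup_le fun N => iSup₂_le fun s hs => ENNReal.ofReal_le_ofReal ?_
  have htel := Finset.sum_range_sub (fun i => F (s i)) N
  rw [hs.1, hs.2.1] at htel
  rw [← htel]
  refine Finset.sum_le_sum fun i hi => ?_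
  have hi := Finset.mem_range.1 hi
  exact hF _ _ (hs.1 ▸ le_of_isPartition hs (Nat.zero_le i) hi.le) (hs.2.2 i hi).le
    (hs.2.1 ▸ le_of_isPartition hs (Nat.succ_le_of_lt hi) le_rfl)

lemma le_curveLength_of_uniform {b : ℝ} {N : ℕ} (hN : N ≠ 0)
    (hb : ∀ i < N, b ≤ ρ (γ (i / N)) (γ ((i + 1 : ℕ) / N))) :
    ENNReal.ofReal (N * b) ≤ curveLength ρ γ := by
  have hN' : (0 : ℝ) < N := by positivity
  have hp : IsPartition N fun i => (i / N : ℝ) := by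
    refine ⟨by simp, by simp [hN], fun i _ => div_lt_div_of_pos_right (by simp) hN'⟩
  refine le_trans (ENNReal.ofReal_le_ofReal ?_) (le_iSup_of_le N (le_iSup₂_of_le _ hp le_rfl))
  have := Finset.card_nsmul_le_sum (Finset.range N)
    (fun i => ρ (γ (i / N)) (γ ((i + 1 : ℕ) / N))) b fun i hi => hb i (Finset.mem_range.1 hi)
  simpa using this

lemma ofReal_le_curveLength : ENNReal.ofReal (ρ (γ 0) (γ 1)) ≤ curveLength ρ γ := by
  have := le_curveLength_of_uniform (ρ := ρ) (γ := γ) (b := ρ (γ 0) (γ 1)) one_ne_zero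
    (by simp)
  simpa using this

lemma ofReal_le_lengthDist (x y : Y) : ENNReal.ofReal (ρ x y) ≤ lengthDist ρ x y := by
  refine le_iInf₂ fun γ hγ => ?_
  rw [← hγ.2.1, ← hγ.2.2]
  exact ofReal_le_curveLength

end Length

lemma vec2_mul (r a b : ℝ) : vec2 (r * a) (r * b) = r • vec2 a b := by
  ext i
  fin_cases i <;> simp [vec2]

lemma norm_vec2_cos_sin (a : ℝ) : ‖vec2 (Real.cos a) (Real.sin a)‖ = 1 := by
  simp [vec2, EuclideanSpace.norm_eq]

lemma inner_vec2_cos_sin (a b : ℝ) :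
    inner ℝ (vec2 (Real.cos a) (Real.sin a)) (vec2 (Real.cos b) (Real.sin b)) =
      Real.cos (b - a) := by
  simp [vec2, PiLp.inner_apply, Real.cos_sub]

lemma sqrt_one_sub_inner_vec2_sq (a b : ℝ) :
    √(1 - inner ℝ (vec2 (Real.cos a) (Real.sin a)) (vec2 (Real.cos b) (Real.sin b)) ^ 2) =
      |Real.sin (b - a)| := by
  rw [inner_vec2_cos_sin, Real.abs_sin_eq_sqrt_one_sub_cos_sq]

lemma dtilde1_radial_le {e : EuclideanSpace ℝ (Fin 2)} (he : ‖e‖ = 1) {r s t : ℝ} (hs : 0 ≤ s)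
    (hst : s ≤ t) (htr : t ≤ r) (hr : r ≤ 1) :
    dtilde1 (s • e) (t • e) ≤ Real.exp (r ^ 2 / 4) * (t ^ 2 - s ^ 2) / √8 ∧
      dtilde1 (t • e) (s • e) ≤ Real.exp (r ^ 2 / 4) * (t ^ 2 - s ^ 2) / √8 := by
  obtain ⟨T, hT⟩ := exists_isTanhFlow
  have h0 : 0 ≤ Real.exp (r ^ 2 / 4) * (t ^ 2 - s ^ 2) / √8 := by
    have : s ^ 2 ≤ t ^ 2 := pow_le_pow_left₀ hs hst 2
    have : 0 ≤ t ^ 2 - s ^ 2 := by linarith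
    positivity
  have h := hT.transportCost_radial_le he hs hst htr hr
  exact ⟨dtilde1_le_of_transportCost_le h0 h.1, dtilde1_le_of_transportCost_le h0 h.2⟩

lemma rho1_le {r : ℝ} (hr : 0 ≤ r) (hr1 : r ≤ 1) :
    rho1 r ≤ ENNReal.ofReal (Real.exp (r ^ 2 / 4) * r ^ 2 / √8) := by
  set e := vec2 1 0 with he_def
  have he : ‖e‖ = 1 := by simpa using norm_vec2_cos_sin 0
  have hre : vec2 r 0 = r • e := by simpa using vec2_mul r 1 0
  set C := Real.exp (r ^ 2 / 4) / √8 with hC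
  have hC0 : 0 ≤ C := by positivity
  have hd : ∀ a b, 0 ≤ a → a ≤ b → b ≤ 1 →
      dtilde1 ((r * a) • e) ((r * b) • e) ≤ C * (r * b) ^ 2 - C * (r * a) ^ 2 ∧
      dtilde1 ((r * b) • e) ((r * a) • e) ≤ C * (r * b) ^ 2 - C * (r * a) ^ 2 := by
    intro a b ha hab hb
    have := dtilde1_radial_le he (r := r) (s := r * a) (t := r * b) (by positivity)
      (by gcongr) (mul_le_of_le_one_right hr hb) hr1
    rw [show C * (r * b) ^ 2 - C * (r * a) ^ 2 =
      Real.exp (r ^ 2 / 4) * ((r * b) ^ 2 - (r * a) ^ 2) / √8 by rw [hC]; ring]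
    exact this
  have hlen : curveLength dtilde1 (fun a => (r * a) • e) ≤
      ENNReal.ofReal (Real.exp (r ^ 2 / 4) * r ^ 2 / √8) := by
    refine (curveLength_le (F := fun a => C * (r * a) ^ 2)
      fun a b ha hab hb => (hd a b ha hab hb).1).trans_eq ?_
    congr 1
    rw [hC]
    ring
  refine (iInf₂_le (fun a => (r * a) • e) ⟨?_, by simp, by simp [hre]⟩).trans hlen
  intro s hs ε hε
  have hlip : ∀ s' ∈ Set.Icc (0 : ℝ) 1, dtilde1 ((r * s) • e) ((r * s') • e) ≤
      C * |(r * s') ^ 2 - (r * s) ^ 2| := by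
    intro s' hs'
    rcases le_total s s' with h | h
    · refine (hd s s' hs.1 h hs'.2).1.trans ?_
      rw [← mul_sub]
      exact mul_le_mul_of_nonneg_left (le_abs_self _) hC0
    · refine (hd s' s hs'.1 h hs.2).2.trans ?_
      rw [← mul_sub, abs_sub_comm]
      exact mul_le_mul_of_nonneg_left (le_abs_self _) hC0
  have hcont : Continuous fun s' : ℝ => C * |(r * s') ^ 2 - (r * s) ^ 2| := by fun_prop
  obtain ⟨δ, hδ, h⟩ := Metric.continuous_iff.1 hcont s ε hε
  refine ⟨δ, hδ, fun s' hs' hss' => (hlip s' hs').trans_lt ?_⟩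
  have := h s' hss'
  rw [sub_self, abs_zero, mul_zero, dist_zero_right] at this
  exact (le_abs_self _).trans_lt this

lemma le_rho1 {r : ℝ} (hr : 0 < r) (hr1 : r ≤ 1) :
    ENNReal.ofReal (r ^ 2 / √(8 + 2 * r ^ 2)) ≤ rho1 r := by
  have he : ‖vec2 1 0‖ = 1 := by simpa using norm_vec2_cos_sin 0
  have hre : vec2 r 0 = r • vec2 1 0 := by simpa using vec2_mul r 1 0
  refine le_trans (ENNReal.ofReal_le_ofReal ?_) (ofReal_le_lengthDist _ _)
  rw [hre]
  exact le_dtilde1_radial he hr hr1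

lemma ell1_le {r : ℝ} (hr : 0 ≤ r) (hr1 : r ≤ 1) :
    ell1 r ≤ ENNReal.ofReal (2 * Real.pi * (Real.exp (r ^ 2 / 4) - 1)) := by
  obtain ⟨T, hT⟩ := exists_isTanhFlow
  have hL : 0 ≤ Real.exp (r ^ 2 / 4) - 1 := sub_nonneg.2 (Real.one_le_exp (by positivity))
  refine (curveLength_le (F := fun a => 2 * (Real.exp (r ^ 2 / 4) - 1) * (Real.pi * a))
    fun a b ha hab hb => ?_).trans_eq (by congr 1; ring)
  rw [vec2_mul, vec2_mul]
  refine (dtilde1_le_of_transportCost_le (by positivity) (hT.transportCost_angular_le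
    (norm_vec2_cos_sin _) (norm_vec2_cos_sin _) ⟨hr, hr1⟩)).trans ?_
  rw [sqrt_one_sub_inner_vec2_sq, ← mul_sub, ← mul_sub, ← mul_sub]
  refine mul_le_mul_of_nonneg_left ?_ (mul_nonneg zero_le_two hL)
  refine Real.abs_sin_le_abs.trans_eq (abs_of_nonneg ?_)
  exact mul_nonneg Real.pi_pos.le (sub_nonneg.2 hab)

lemma le_ell1 {r : ℝ} (hr : 0 < r) (hr1 : r ≤ 1) :
    ENNReal.ofReal (Real.pi * (r ^ 2 / √(4 + 2 * r ^ 2))) ≤ ell1 r := by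
  set A := r ^ 2 / √(4 + 2 * r ^ 2) with hA
  have hA0 : 0 ≤ A := by positivity
  have hN : ∀ N : ℕ, N ≠ 0 → ENNReal.ofReal (N * (A * Real.sin (Real.pi / N))) ≤ ell1 r := by
    intro N hN
    refine le_curveLength_of_uniform hN fun i _ => ?_
    rw [vec2_mul, vec2_mul]
    refine le_trans ?_ (le_dtilde1_angular (norm_vec2_cos_sin _) (norm_vec2_cos_sin _) hr hr1)
    rw [sqrt_one_sub_inner_vec2_sq]
    refine mul_le_mul_of_nonneg_left ((le_of_eq ?_).trans (le_abs_self _)) hA0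
    congr 1
    push_cast
    ring
  have hsin : Filter.Tendsto (fun N : ℕ => (N : ℝ) * (A * Real.sin (Real.pi / N)))
      Filter.atTop (nhds (Real.pi * A)) := by
    have h0 : Filter.Tendsto (fun N : ℕ => Real.pi / (N : ℝ)) Filter.atTop (nhds 0) :=
      tendsto_const_nhds.div_atTop tendsto_natCast_atTop_atTop
    have h1 := ((Real.continuous_sinc.tendsto 0).comp h0).const_mul (Real.pi * A)
    rw [Real.sinc_zero, mul_one] at h1
    refine h1.congr' ?_
    filter_upwards [Filter.eventually_ne_atTop 0] with N hN0
    have : (N : ℝ) ≠ 0 := by exact_mod_cast hN0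
    have := Real.pi_ne_zero
    simp only [Function.comp_apply]
    rw [Real.sinc_of_ne_zero (by positivity)]
    field_simp
  refine le_of_tendsto ((ENNReal.continuous_ofReal.tendsto _).comp hsin) ?_
  filter_upwards [Filter.eventually_ne_atTop 0] with N hN0 using hN N hN0

lemma ell1_div_rho1_bounds {r : ℝ} (hr : 0 < r) (hr1 : r ≤ 1) :
    Real.pi * √8 / (√(4 + 2 * r ^ 2) * Real.exp (r ^ 2 / 4)) ≤
      (ell1 r).toReal / (rho1 r).toReal ∧
    (ell1 r).toReal / (rho1 r).toReal ≤
      Real.pi / 2 * Real.exp (r ^ 2 / 4) * √(8 + 2 * r ^ 2) := by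
  have hexp : Real.exp (r ^ 2 / 4) - 1 ≤ r ^ 2 / 4 * Real.exp (r ^ 2 / 4) := by
    have h1 := Real.add_one_le_exp (-(r ^ 2 / 4))
    have h2 : Real.exp (-(r ^ 2 / 4)) * Real.exp (r ^ 2 / 4) = 1 := by
      rw [← Real.exp_add, neg_add_cancel, Real.exp_zero]
    nlinarith [Real.exp_pos (r ^ 2 / 4)]
  have hL : 0 ≤ Real.exp (r ^ 2 / 4) - 1 := sub_nonneg.2 (Real.one_le_exp (by positivity))
  have ell_le := ENNReal.toReal_le_of_le_ofReal (mul_nonneg (by positivity) hL) (ell1_le hr.le hr1)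
  have rho_le := ENNReal.toReal_le_of_le_ofReal (by positivity) (rho1_le hr.le hr1)
  have le_ell := (ENNReal.ofReal_le_iff_le_toReal
    (ne_top_of_le_ne_top ENNReal.ofReal_ne_top (ell1_le hr.le hr1))).1 (le_ell1 hr hr1)
  have le_rho := (ENNReal.ofReal_le_iff_le_toReal
    (ne_top_of_le_ne_top ENNReal.ofReal_ne_top (rho1_le hr.le hr1))).1 (le_rho1 hr hr1)
  have hlow : 0 < r ^ 2 / √(8 + 2 * r ^ 2) := by positivity
  have hrho := hlow.trans_le le_rho
  constructor
  · calc Real.pi * √8 / (√(4 + 2 * r ^ 2) * Real.exp (r ^ 2 / 4))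
        = Real.pi * (r ^ 2 / √(4 + 2 * r ^ 2)) / (Real.exp (r ^ 2 / 4) * r ^ 2 / √8) := by
          field_simp
      _ ≤ (ell1 r).toReal / (rho1 r).toReal :=
          div_le_div₀ ENNReal.toReal_nonneg le_ell hrho rho_le
  · calc (ell1 r).toReal / (rho1 r).toReal
        ≤ 2 * Real.pi * (r ^ 2 / 4 * Real.exp (r ^ 2 / 4)) / (r ^ 2 / √(8 + 2 * r ^ 2)) :=
          div_le_div₀ (by positivity)
            (ell_le.trans (mul_le_mul_of_nonneg_left hexp (by positivity))) hlow le_rho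
      _ = Real.pi / 2 * Real.exp (r ^ 2 / 4) * √(8 + 2 * r ^ 2) := by
          field_simp
          ring

end ConeHeat

/-- for the Gigli–Mantegazza distance `d₁`, the cone `C(π)` has a conic
singularity of angle `√2·π` at the apex: `ℓ(r)/ρ(r) → √2·π` as `r → 0⁺`. -/
theorem stmt15 :
    Filter.Tendsto (fun r : ℝ => (ell1 r).toReal / (rho1 r).toReal)
      (nhdsWithin 0 (Set.Ioi 0)) (nhds (Real.sqrt 2 * Real.pi)) := by
  have h8 : √8 = 2 * √2 := by
    rw [show (8 : ℝ) = 2 ^ 2 * 2 by norm_num, Real.sqrt_mul (by norm_num),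
      Real.sqrt_sq (by norm_num)]
  have h4 : √4 = 2 := by
    rw [show (4 : ℝ) = 2 ^ 2 by norm_num, Real.sqrt_sq (by norm_num)]
  have hlow : Filter.Tendsto
      (fun r : ℝ => Real.pi * √8 / (√(4 + 2 * r ^ 2) * Real.exp (r ^ 2 / 4)))
      (nhdsWithin 0 (Set.Ioi 0)) (nhds (√2 * Real.pi)) := by
    have hc : Continuous
        fun r : ℝ => Real.pi * √8 / (√(4 + 2 * r ^ 2) * Real.exp (r ^ 2 / 4)) :=
      Continuous.div (by fun_prop) (by fun_prop) fun r => by positivity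
    refine tendsto_nhdsWithin_of_tendsto_nhds (hc.tendsto' 0 _ ?_)
    norm_num [h4, h8]
    ring
  have hupp : Filter.Tendsto
      (fun r : ℝ => Real.pi / 2 * Real.exp (r ^ 2 / 4) * √(8 + 2 * r ^ 2))
      (nhdsWithin 0 (Set.Ioi 0)) (nhds (√2 * Real.pi)) := by
    have hc : Continuous
        fun r : ℝ => Real.pi / 2 * Real.exp (r ^ 2 / 4) * √(8 + 2 * r ^ 2) := by fun_prop
    refine tendsto_nhdsWithin_of_tendsto_nhds (hc.tendsto' 0 _ ?_)
    norm_num [h8]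
    ring
  have hev : ∀ᶠ r : ℝ in nhdsWithin 0 (Set.Ioi 0), 0 < r ∧ r ≤ 1 :=
    Filter.Eventually.and self_mem_nhdsWithin
      (mem_nhdsWithin_of_mem_nhds (Iic_mem_nhds one_pos))
  exact tendsto_of_tendsto_of_tendsto_of_le_of_le' hlow hupp
    (hev.mono fun r hr => (ConeHeat.ell1_div_rho1_bounds hr.1 hr.2).1)
    (hev.mono fun r hr => (ConeHeat.ell1_div_rho1_bounds hr.1 hr.2).2)
end

section
/- On ℝ² ≅ ℂ define d̃₁(z,w) := W₄(ν_z, ν_w) and let d₁ be the induced length distance. For r > 0 set ρ(r) := d₁(0, (r,0)) (the d₁-distance from the apex of C(π/2) to a point at cone-distance r) and ℓ(r) := the d̃₁-length of the curve [0, π/2] ∋ s ↦ r(cos s, sin s), i.e. the supremum over partitions 0 = s₀ < ⋯ < s_N = π/2 of Σᵢ d̃₁(r(cos sᵢ, sin sᵢ), r(cos sᵢ₊₁, sin sᵢ₊₁)) (the length of the circle of radius r around the apex, which closes up in the quotient C(π/2)). Then lim_{r→0⁺} ℓ(r)/ρ(r) = 0; i.e. for the Gigli–Mantegazza distance d₁,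 the cone C(π/2) has angle zero at the apex. -/
open MeasureTheory ENNReal

/-- The derivative of `η`: `η'(y) = -(y/2) η(y)`. -/
noncomputable def η' (y : ℝ) : ℝ := -(y / 2) * η y

/-- The density `f_x` of the symmetric lift `μ_x^1 = ½(γ_x^1 + γ_{-x}^1)` of the time-1
heat kernel measure on the cone `C(π)`. -/
noncomputable def fPi (x y : EuclideanSpace ℝ (Fin 2)) : ℝ :=
  2⁻¹ * (η (y 0 - x 0) * η (y 1 - x 1) + η (y 0 + x 0) * η (y 1 + x 1))

/-- The symmetric lift `μ_x^1` itself. -/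
noncomputable def muPi (x : EuclideanSpace ℝ (Fin 2)) :
    Measure (EuclideanSpace ℝ (Fin 2)) :=
  volume.withDensity fun y => ENNReal.ofReal (fPi x y)
/-- Rotation by `π/2` (multiplication by `i` under `ℝ² ≅ ℂ`). -/
noncomputable def rot (z : EuclideanSpace ℝ (Fin 2)) : EuclideanSpace ℝ (Fin 2) :=
  vec2 (-(z 1)) (z 0)

/-- The density `f_z` of the symmetric lift `ν_z = ¼(γ_z¹ + γ_{iz}¹ + γ_{-z}¹ + γ_{-iz}¹)`
of the time-1 heat kernel measure on the cone `C(π/2)`. -/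
noncomputable def fQ (z y : EuclideanSpace ℝ (Fin 2)) : ℝ :=
  4⁻¹ * (η (y 0 - z 0) * η (y 1 - z 1)
    + η (y 0 - rot z 0) * η (y 1 - rot z 1)
    + η (y 0 + z 0) * η (y 1 + z 1)
    + η (y 0 + rot z 0) * η (y 1 + rot z 1))

/-- The symmetric lift `ν_z` itself. -/
noncomputable def nuQ (z : EuclideanSpace ℝ (Fin 2)) :
    Measure (EuclideanSpace ℝ (Fin 2)) :=
  volume.withDensity fun y => ENNReal.ofReal (fQ z y)
/-- The quarter-cone cost on `ℝ² ≅ ℂ`: `c₄(z,w) = min_k |z - iᵏ w|`. -/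
noncomputable def quarterCost (z w : EuclideanSpace ℝ (Fin 2)) : ℝ :=
  min (min ‖z - w‖ ‖z - rot w‖) (min ‖z + w‖ ‖z + rot w‖)

/-- The Gigli–Mantegazza chord distance at time 1 on (the lift of) the cone `C(π/2)`. -/
noncomputable def dtildeQ (z w : EuclideanSpace ℝ (Fin 2)) : ℝ :=
  W2 quarterCost (nuQ z) (nuQ w)

/-- The `d₁`-distance from the apex of `C(π/2)` to a point at cone-distance `r`. -/
noncomputable def rhoQ (r : ℝ) : ℝ≥0∞ :=
  lengthDist dtildeQ 0 (vec2 r 0)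

/-- The `d̃₁`-length of the circle of radius `r` around the apex of `C(π/2)` (the curve
`s ∈ [0,1] ↦ r(cos(πs/2), sin(πs/2))`, which closes up in the quotient). -/
noncomputable def ellQ (r : ℝ) : ℝ≥0∞ :=
  curveLength dtildeQ fun s =>
    vec2 (r * Real.cos (Real.pi * s / 2)) (r * Real.sin (Real.pi * s / 2))

/-! ### The angular density and its quantile function -/

/-- The angular profile of the density of `ν_z` on a circle around the origin. -/
noncomputable def angDens (a ψ : ℝ) : ℝ :=
  (Real.cosh (a * Real.cos ψ) + Real.cosh (a * Real.sin ψ)) / 2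

/-- The mean value of `angDens a` over a period. -/
noncomputable def angMean (a : ℝ) : ℝ :=
  (∫ x in (-Real.pi)..Real.pi, angDens a x) / (2 * Real.pi)

/-- The primitive of `angDens a`, normalised so as to commute with translations by `2π`. -/
noncomputable def angCdf (a ψ : ℝ) : ℝ := (∫ x in 0..ψ, angDens a x) / angMean a

theorem continuous_angDens_uncurry : Continuous (Function.uncurry angDens) := by
  unfold Function.uncurry angDens
  fun_prop

theorem continuous_angDens (a : ℝ) : Continuous (angDens a) :=
  continuous_angDens_uncurry.comp (Continuous.prodMk_right a)

theorem intervalIntegrable_angDens (a x y : ℝ) :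
    IntervalIntegrable (angDens a) volume x y :=
  (continuous_angDens a).intervalIntegrable _ _

theorem one_le_angDens (a ψ : ℝ) : 1 ≤ angDens a ψ := by
  unfold angDens
  linarith [Real.one_le_cosh (a * Real.cos ψ), Real.one_le_cosh (a * Real.sin ψ)]

theorem periodic_angDens (a : ℝ) : Function.Periodic (angDens a) (2 * Real.pi) := by
  intro x
  simp [angDens]

theorem Real.cosh_le_exp_abs (x : ℝ) : Real.cosh x ≤ Real.exp |x| := by
  rw [Real.cosh_eq]
  have h1 := Real.exp_le_exp.2 (le_abs_self x)
  have h2 := Real.exp_le_exp.2 (neg_le_abs x)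
  linarith

theorem abs_mul_cos_le {a : ℝ} (ha : 0 ≤ a) (x : ℝ) : |a * Real.cos x| ≤ a := by
  rw [abs_mul, abs_of_nonneg ha]
  exact mul_le_of_le_one_right ha (Real.abs_cos_le_one x)

theorem abs_mul_sin_le {a : ℝ} (ha : 0 ≤ a) (x : ℝ) : |a * Real.sin x| ≤ a := by
  rw [abs_mul, abs_of_nonneg ha]
  exact mul_le_of_le_one_right ha (Real.abs_sin_le_one x)

theorem angDens_le_exp {a : ℝ} (ha : 0 ≤ a) (ψ : ℝ) : angDens a ψ ≤ Real.exp a := by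
  unfold angDens
  have h1 := (Real.cosh_le_exp_abs (a * Real.cos ψ)).trans
    (Real.exp_le_exp.2 (abs_mul_cos_le ha ψ))
  have h2 := (Real.cosh_le_exp_abs (a * Real.sin ψ)).trans
    (Real.exp_le_exp.2 (abs_mul_sin_le ha ψ))
  linarith

theorem Real.abs_cosh_sub_le (x : ℝ) :
    |Real.cosh x - (1 + x ^ 2 / 2)| ≤ x ^ 4 * Real.exp |x| := by
  have key (y : ℝ) : |Real.exp y - (1 + y + y ^ 2 / 2 + y ^ 3 / 6)| ≤ y ^ 4 * Real.exp |y| := by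
    have h := Complex.norm_exp_sub_sum_le_norm_mul_exp (y : ℂ) 4
    have e : Complex.exp (y : ℂ) - ∑ m ∈ Finset.range 4, (y : ℂ) ^ m / (m.factorial : ℂ)
        = ((Real.exp y - (1 + y + y ^ 2 / 2 + y ^ 3 / 6) : ℝ) : ℂ) := by
      simp [Finset.sum_range_succ, Nat.factorial]
    rw [e, Complex.norm_real, Complex.norm_real, Real.norm_eq_abs, Real.norm_eq_abs] at h
    rwa [Even.pow_abs (by decide)] at h
  have h1 := abs_le.1 (key x)
  have h2 := abs_le.1 (key (-x))
  rw [abs_neg] at h2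
  rw [Real.cosh_eq, abs_le]
  constructor <;> nlinarith [h1.1, h1.2, h2.1, h2.2]

theorem abs_angDens_sub_le {a : ℝ} (ha : 0 ≤ a) (ψ : ℝ) :
    |angDens a ψ - (1 + a ^ 2 / 4)| ≤ a ^ 4 * Real.exp a / 2 := by
  have h1 := Real.abs_cosh_sub_le (a * Real.cos ψ)
  have h2 := Real.abs_cosh_sub_le (a * Real.sin ψ)
  have e1 := Real.exp_le_exp.2 (abs_mul_cos_le ha ψ)
  have e2 := Real.exp_le_exp.2 (abs_mul_sin_le ha ψ)
  have h1' : |Real.cosh (a * Real.cos ψ) - (1 + (a * Real.cos ψ) ^ 2 / 2)|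
      ≤ (a * Real.cos ψ) ^ 4 * Real.exp a :=
    h1.trans (mul_le_mul_of_nonneg_left e1 (by positivity))
  have h2' : |Real.cosh (a * Real.sin ψ) - (1 + (a * Real.sin ψ) ^ 2 / 2)|
      ≤ (a * Real.sin ψ) ^ 4 * Real.exp a :=
    h2.trans (mul_le_mul_of_nonneg_left e2 (by positivity))
  have hcs := Real.sin_sq_add_cos_sq ψ
  have h4 : (a * Real.cos ψ) ^ 4 + (a * Real.sin ψ) ^ 4 ≤ a ^ 4 := by
    have : (a * Real.cos ψ) ^ 4 + (a * Real.sin ψ) ^ 4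
        = a ^ 4 * (1 - 2 * (Real.sin ψ * Real.cos ψ) ^ 2) := by
      have hc : Real.cos ψ ^ 2 = 1 - Real.sin ψ ^ 2 := by linarith
      have hc4 : Real.cos ψ ^ 4 = (1 - Real.sin ψ ^ 2) ^ 2 := by rw [← hc]; ring
      rw [mul_pow, mul_pow, mul_pow, hc, hc4]; ring
    rw [this]
    apply mul_le_of_le_one_right (by positivity)
    nlinarith [sq_nonneg (Real.sin ψ * Real.cos ψ)]
  have h4' := mul_le_mul_of_nonneg_right h4 (Real.exp_pos a).le
  have h2q : (a * Real.cos ψ) ^ 2 + (a * Real.sin ψ) ^ 2 = a ^ 2 := by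
    linear_combination a ^ 2 * hcs
  rw [abs_le] at h1' h2' ⊢
  unfold angDens
  constructor <;> nlinarith [h1'.1, h1'.2, h2'.1, h2'.2]

theorem angMean_le_of_le {a c : ℝ} (h : ∀ x, angDens a x ≤ c) : angMean a ≤ c := by
  unfold angMean
  rw [div_le_iff₀ (by positivity)]
  have := intervalIntegral.integral_mono_on (a := -Real.pi) (b := Real.pi) (μ := volume)
    (by linarith [Real.pi_pos]) (intervalIntegrable_angDens a _ _)
    (intervalIntegrable_const (c := c)) (fun x _ => h x)
  rw [intervalIntegral.integral_const, smul_eq_mul] at this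
  linarith

theorem le_angMean_of_le {a c : ℝ} (h : ∀ x, c ≤ angDens a x) : c ≤ angMean a := by
  unfold angMean
  rw [le_div_iff₀ (by positivity)]
  have := intervalIntegral.integral_mono_on (a := -Real.pi) (b := Real.pi) (μ := volume)
    (by linarith [Real.pi_pos]) (intervalIntegrable_const (c := c))
    (intervalIntegrable_angDens a _ _) (fun x _ => h x)
  rw [intervalIntegral.integral_const, smul_eq_mul] at this
  linarith

theorem one_le_angMean (a : ℝ) : 1 ≤ angMean a := le_angMean_of_le (one_le_angDens a)

theorem angMean_pos (a : ℝ) : 0 < angMean a := one_pos.trans_le (one_le_angMean a)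

theorem abs_angDens_sub_angMean_le {a : ℝ} (ha : 0 ≤ a) (ψ : ℝ) :
    |angDens a ψ - angMean a| ≤ a ^ 4 * Real.exp a := by
  have h := fun x => abs_le.1 (abs_angDens_sub_le ha x)
  have h1 : angMean a ≤ 1 + a ^ 2 / 4 + a ^ 4 * Real.exp a / 2 :=
    angMean_le_of_le fun x => by linarith [(h x).2]
  have h2 : 1 + a ^ 2 / 4 - a ^ 4 * Real.exp a / 2 ≤ angMean a :=
    le_angMean_of_le fun x => by linarith [(h x).1]
  rw [abs_le]
  constructor <;> linarith [(h ψ).1, (h ψ).2]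

theorem continuous_angMean : Continuous angMean :=
  (intervalIntegral.continuous_parametric_intervalIntegral_of_continuous'
    continuous_angDens_uncurry _ _).div_const _

theorem continuous_angCdf_left (ψ : ℝ) : Continuous fun a => angCdf a ψ :=
  (intervalIntegral.continuous_parametric_intervalIntegral_of_continuous'
    continuous_angDens_uncurry _ _).div continuous_angMean fun a => (angMean_pos a).ne'

theorem hasDerivAt_angCdf (a ψ : ℝ) : HasDerivAt (angCdf a) (angDens a ψ / angMean a) ψ :=
  ((continuous_angDens a).integral_hasStrictDerivAt 0 ψ).hasDerivAt.div_const _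

theorem angCdf_sub (a x y : ℝ) :
    angCdf a y - angCdf a x = (∫ t in x..y, angDens a t) / angMean a := by
  unfold angCdf
  rw [← sub_div, intervalIntegral.integral_interval_sub_left] <;>
    exact intervalIntegrable_angDens _ _ _

theorem angCdf_add_two_pi (a ψ : ℝ) : angCdf a (ψ + 2 * Real.pi) = angCdf a ψ + 2 * Real.pi := by
  have h := angCdf_sub a ψ (ψ + 2 * Real.pi)
  have h2 := (periodic_angDens a).intervalIntegral_add_eq ψ (-Real.pi)
  rw [show -Real.pi + 2 * Real.pi = Real.pi by ring] at h2
  have h3 : (∫ x in (-Real.pi)..Real.pi, angDens a x) = angMean a * (2 * Real.pi) := by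
    unfold angMean
    field_simp
  rw [h2, h3, mul_div_cancel_left₀ _ (angMean_pos a).ne'] at h
  linarith

theorem strictMono_angCdf (a : ℝ) : StrictMono (angCdf a) :=
  strictMono_of_hasDerivAt_pos (fun x => hasDerivAt_angCdf a x) fun x =>
    div_pos (one_pos.trans_le (one_le_angDens a x)) (angMean_pos a)

theorem continuous_angCdf (a : ℝ) : Continuous (angCdf a) :=
  continuous_iff_continuousAt.2 fun x => (hasDerivAt_angCdf a x).continuousAt

theorem sub_le_integral_angDens (a : ℝ) {x y : ℝ} (h : x ≤ y) :
    y - x ≤ ∫ t in x..y, angDens a t := by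
  have := intervalIntegral.integral_mono_on (μ := volume) h (intervalIntegrable_const (c := (1 : ℝ)))
    (intervalIntegrable_angDens a _ _) (fun t _ => one_le_angDens a t)
  simpa using this

theorem surjective_angCdf (a : ℝ) : Function.Surjective (angCdf a) := by
  have hm := angMean_pos a
  apply (continuous_angCdf a).surjective
  · refine Filter.tendsto_atTop_mono' _ ?_ (Filter.tendsto_id.atTop_div_const hm)
    filter_upwards [Filter.eventually_ge_atTop 0] with x hx
    have := sub_le_integral_angDens a hx
    exact div_le_div_of_nonneg_right (by simpa using this) hm.le
  · refine Filter.tendsto_atBot_mono' _ ?_ (Filter.tendsto_id.atBot_div_const hm)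
    filter_upwards [Filter.eventually_le_atBot 0] with x hx
    have := sub_le_integral_angDens a hx
    refine div_le_div_of_nonneg_right ?_ hm.le
    rw [intervalIntegral.integral_symm, id]
    linarith

/-- The inverse function of `angCdf a`. -/
noncomputable def angQuantile (a : ℝ) : ℝ ≃o ℝ :=
  ((strictMono_angCdf a).orderIsoOfSurjective _ (surjective_angCdf a)).symm

@[simp]
theorem angQuantile_angCdf (a ψ : ℝ) : angQuantile a (angCdf a ψ) = ψ :=
  (strictMono_angCdf a).orderIsoOfSurjective_symm_apply_self _ (surjective_angCdf a) ψ

@[simp]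
theorem angCdf_angQuantile (a t : ℝ) : angCdf a (angQuantile a t) = t :=
  (strictMono_angCdf a).orderIsoOfSurjective_self_symm_apply _ (surjective_angCdf a) t

theorem angQuantile_add_two_pi (a t : ℝ) :
    angQuantile a (t + 2 * Real.pi) = angQuantile a t + 2 * Real.pi := by
  apply (strictMono_angCdf a).injective
  simp [angCdf_add_two_pi]

theorem measurable_angQuantile_uncurry :
    Measurable fun p : ℝ × ℝ => angQuantile p.1 p.2 := by
  refine measurable_of_Iic fun c => ?_
  have : (fun p : ℝ × ℝ => angQuantile p.1 p.2) ⁻¹' Set.Iic c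
      = {p : ℝ × ℝ | p.2 ≤ angCdf p.1 c} := by
    ext p
    simp only [Set.mem_preimage, Set.mem_Iic, Set.mem_ofPred_eq]
    rw [← (strictMono_angCdf p.1).le_iff_le, angCdf_angQuantile]
  rw [this]
  exact measurableSet_le measurable_snd ((continuous_angCdf_left c).measurable.comp measurable_fst)

/-- Translating by `Δ` on the quantile side moves points by `Δ` up to a relative error which is of
fourth order in `a`. -/
theorem abs_angQuantile_sub_le {a : ℝ} (ha : 0 ≤ a) (t : ℝ) {Δ : ℝ} (hΔ : 0 ≤ Δ) :
    |angQuantile a t - angQuantile a (t - Δ) - Δ| ≤ a ^ 4 * Real.exp a * Δ := by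
  set x := angQuantile a (t - Δ) with hx
  set y := angQuantile a t with hy
  set m := angMean a with hm
  have hm1 : 1 ≤ m := one_le_angMean a
  have hxy : x ≤ y := (angQuantile a).monotone (by linarith)
  have hI : ∫ u in x..y, angDens a u = m * Δ := by
    have h := angCdf_sub a x y
    rw [hx, hy, angCdf_angQuantile, angCdf_angQuantile, eq_div_iff (angMean_pos a).ne'] at h
    linarith
  have h1 : y - x ≤ m * Δ := hI ▸ sub_le_integral_angDens a hxy
  set δ := a ^ 4 * Real.exp a with hδ
  have hδ0 : 0 ≤ δ := by positivity
  have hb := fun u => abs_le.1 (abs_angDens_sub_angMean_le ha u)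
  have h2 := intervalIntegral.integral_mono_on (μ := volume) hxy
    (intervalIntegrable_angDens a _ _) (intervalIntegrable_const (c := m + δ))
    (fun u _ => by linarith [(hb u).2])
  have h3 := intervalIntegral.integral_mono_on (μ := volume) hxy
    (intervalIntegrable_const (c := m - δ)) (intervalIntegrable_angDens a _ _)
    (fun u _ => by linarith [(hb u).1])
  rw [hI, intervalIntegral.integral_const, smul_eq_mul] at h2 h3
  have h4 : m * |y - x - Δ| ≤ m * (δ * Δ) := by
    rw [← abs_of_nonneg (by linarith : 0 ≤ m), ← abs_mul, abs_of_nonneg (by linarith : 0 ≤ m),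
      abs_le]
    have := mul_le_mul_of_nonneg_left h1 hδ0
    constructor <;> nlinarith
  exact le_of_mul_le_mul_left h4 (by linarith)

theorem setLIntegral_Ioc_eq_of_periodic {G : ℝ → ℝ≥0∞} {T : ℝ} (hT : 0 < T)
    (hG : Function.Periodic G T) (a b : ℝ) :
    ∫⁻ x in Set.Ioc a (a + T), G x = ∫⁻ x in Set.Ioc b (b + T), G x := by
  refine (isAddFundamentalDomain_Ioc hT a).setLIntegral_eq (isAddFundamentalDomain_Ioc hT b) G ?_
  rintro ⟨_, n, rfl⟩ x
  simpa [AddSubgroup.vadd_def, add_comm] using hG.zsmul n x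

theorem setLIntegral_Ioc_comp_sub_of_periodic {G : ℝ → ℝ≥0∞} {T : ℝ} (hT : 0 < T)
    (hG : Function.Periodic G T) (a c : ℝ) :
    ∫⁻ x in Set.Ioc a (a + T), G (x - c) = ∫⁻ x in Set.Ioc a (a + T), G x := by
  have h := (measurePreserving_sub_right volume c).setLIntegral_comp_emb
    (MeasurableEquiv.subRight c).measurableEmbedding G (Set.Ioc a (a + T))
  rw [h, Set.image_sub_const_Ioc, add_sub_right_comm]
  exact setLIntegral_Ioc_eq_of_periodic hT hG _ _

/-- Integration against `angDens a` over a period, in the quantile variable. -/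
theorem setLIntegral_angDens_mul (a : ℝ) {G : ℝ → ℝ≥0∞} (hG : Function.Periodic G (2 * Real.pi))
    (Δ : ℝ) :
    ∫⁻ ψ in Set.Ioc (-Real.pi) (-Real.pi + 2 * Real.pi), ENNReal.ofReal (angDens a ψ) * G ψ
      = ENNReal.ofReal (angMean a) *
        ∫⁻ t in Set.Ioc (-Real.pi) (-Real.pi + 2 * Real.pi), G (angQuantile a (t - Δ)) := by
  have hper : Function.Periodic (fun t => G (angQuantile a t)) (2 * Real.pi) := fun t => by
    simp only [angQuantile_add_two_pi, hG _]
  rw [setLIntegral_Ioc_comp_sub_of_periodic (G := fun t => G (angQuantile a t))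
    Real.two_pi_pos hper, setLIntegral_Ioc_eq_of_periodic Real.two_pi_pos hper _
    (angCdf a (-Real.pi)), ← angCdf_add_two_pi]
  have him : angCdf a '' Set.Ioc (-Real.pi) (-Real.pi + 2 * Real.pi)
      = Set.Ioc (angCdf a (-Real.pi)) (angCdf a (-Real.pi + 2 * Real.pi)) :=
    ((strictMono_angCdf a).orderIsoOfSurjective _ (surjective_angCdf a)).image_Ioc _ _
  rw [← him, lintegral_image_eq_lintegral_abs_deriv_mul measurableSet_Ioc
    (fun x _ => (hasDerivAt_angCdf a x).hasDerivWithinAt) (strictMono_angCdf a).injective.injOn,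
    ← lintegral_const_mul' _ _ ENNReal.ofReal_ne_top]
  refine lintegral_congr fun x => ?_
  have hd := one_pos.trans_le (one_le_angDens a x)
  have hm := angMean_pos a
  rw [angQuantile_angCdf, ← mul_assoc, ← ENNReal.ofReal_mul hm.le, abs_of_pos (div_pos hd hm),
    mul_div_cancel₀ _ hm.ne']

/-! ### Polar coordinates -/

/-- The point of the plane with polar coordinates `(R, φ)`. -/
noncomputable def polarPt (R φ : ℝ) : EuclideanSpace ℝ (Fin 2) :=
  vec2 (R * Real.cos φ) (R * Real.sin φ)

@[simp] theorem vec2_apply_zero (a b : ℝ) : vec2 a b 0 = a := rfl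

@[simp] theorem vec2_apply_one (a b : ℝ) : vec2 a b 1 = b := rfl

theorem norm_sq_eq (y : EuclideanSpace ℝ (Fin 2)) : ‖y‖ ^ 2 = y 0 ^ 2 + y 1 ^ 2 := by
  simp [EuclideanSpace.norm_sq_eq, Fin.sum_univ_two]

theorem measurePreserving_vec2 :
    MeasurePreserving (fun p : ℝ × ℝ => vec2 p.1 p.2) volume volume :=
  (EuclideanSpace.volume_preserving_symm_measurableEquiv_toLp (Fin 2)).symm.comp
    (volume_preserving_finTwoArrow ℝ).symm

theorem measurable_vec2_uncurry : Measurable fun p : ℝ × ℝ => vec2 p.1 p.2 :=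
  measurePreserving_vec2.measurable

theorem measurable_polarPt_uncurry : Measurable fun p : ℝ × ℝ => polarPt p.1 p.2 :=
  measurable_vec2_uncurry.comp (f := fun p : ℝ × ℝ => (p.1 * Real.cos p.2, p.1 * Real.sin p.2))
    (by fun_prop)

theorem polarPt_add_two_pi (R φ : ℝ) : polarPt R (φ + 2 * Real.pi) = polarPt R φ := by
  simp [polarPt]

theorem dist_polarPt_le {R : ℝ} (hR : 0 ≤ R) (α β : ℝ) :
    ‖polarPt R α - polarPt R β‖ ≤ R * |α - β| := by
  apply le_of_sq_le_sq _ (by positivity)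
  rw [norm_sq_eq, mul_pow, sq_abs]
  simp only [polarPt, PiLp.sub_apply, vec2_apply_zero, vec2_apply_one]
  have h := Real.one_sub_sq_div_two_le_cos (x := α - β)
  rw [Real.cos_sub] at h
  have h1 := Real.sin_sq_add_cos_sq α
  have h2 := Real.sin_sq_add_cos_sq β
  have : (R * Real.cos α - R * Real.cos β) ^ 2 + (R * Real.sin α - R * Real.sin β) ^ 2
      = R ^ 2 * (2 - 2 * (Real.cos α * Real.cos β + Real.sin α * Real.sin β)) := by
    linear_combination R ^ 2 * h1 + R ^ 2 * h2
  rw [this]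
  exact mul_le_mul_of_nonneg_left (by linarith) (by positivity)

theorem lintegral_eq_lintegral_polarPt {F : EuclideanSpace ℝ (Fin 2) → ℝ≥0∞} (hF : Measurable F) :
    ∫⁻ y, F y = ∫⁻ R in Set.Ioi (0 : ℝ),
      ∫⁻ φ in Set.Ioc (-Real.pi) (-Real.pi + 2 * Real.pi),
        ENNReal.ofReal R * F (polarPt R φ) := by
  have hm : Measurable fun p : ℝ × ℝ => ENNReal.ofReal p.1 * F (polarPt p.1 p.2) :=
    (ENNReal.measurable_ofReal.comp measurable_fst).mul (hF.comp measurable_polarPt_uncurry)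
  rw [← measurePreserving_vec2.lintegral_comp hF, ← lintegral_comp_polarCoord_symm,
    polarCoord_target, Measure.volume_eq_prod, ← Measure.prod_restrict,
    lintegral_prod _ (by exact hm.aemeasurable)]
  refine lintegral_congr fun R => ?_
  rw [show -Real.pi + 2 * Real.pi = Real.pi by ring]
  exact setLIntegral_congr Ioo_ae_eq_Ioc

theorem η_mul_η (u v : ℝ) :
    η u * η v = (4 * Real.pi)⁻¹ * Real.exp (-(u ^ 2 + v ^ 2) / 4) := by
  have h : (Real.sqrt (4 * Real.pi))⁻¹ * (Real.sqrt (4 * Real.pi))⁻¹ = (4 * Real.pi)⁻¹ := by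
    rw [← mul_inv, Real.mul_self_sqrt (by positivity)]
  unfold η
  rw [mul_mul_mul_comm, h, ← Real.exp_add]
  ring_nf

theorem fQ_polarPt (r θ R φ : ℝ) :
    fQ (polarPt r θ) (polarPt R φ) = (4 * Real.pi)⁻¹ * Real.exp (-(R ^ 2 + r ^ 2) / 4) *
      angDens (r * R / 2) (φ - θ) := by
  have h1 := Real.sin_sq_add_cos_sq θ
  have h2 := Real.sin_sq_add_cos_sq φ
  simp only [fQ, rot, polarPt, vec2_apply_zero, vec2_apply_one, η_mul_η]
  unfold angDens
  rw [Real.cosh_eq, Real.cosh_eq, Real.cos_sub, Real.sin_sub]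
  have e1 : -((R * Real.cos φ - r * Real.cos θ) ^ 2 + (R * Real.sin φ - r * Real.sin θ) ^ 2) / 4
      = -(R ^ 2 + r ^ 2) / 4
        + r * R / 2 * (Real.cos φ * Real.cos θ + Real.sin φ * Real.sin θ) := by
    linear_combination (-R ^ 2 / 4) * h2 - r ^ 2 / 4 * h1
  have e2 : -((R * Real.cos φ - -(r * Real.sin θ)) ^ 2 + (R * Real.sin φ - r * Real.cos θ) ^ 2) / 4
      = -(R ^ 2 + r ^ 2) / 4
        + r * R / 2 * (Real.sin φ * Real.cos θ - Real.cos φ * Real.sin θ) := by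
    linear_combination (-R ^ 2 / 4) * h2 - r ^ 2 / 4 * h1
  have e3 : -((R * Real.cos φ + r * Real.cos θ) ^ 2 + (R * Real.sin φ + r * Real.sin θ) ^ 2) / 4
      = -(R ^ 2 + r ^ 2) / 4
        + -(r * R / 2 * (Real.cos φ * Real.cos θ + Real.sin φ * Real.sin θ)) := by
    linear_combination (-R ^ 2 / 4) * h2 - r ^ 2 / 4 * h1
  have e4 : -((R * Real.cos φ + -(r * Real.sin θ)) ^ 2 + (R * Real.sin φ + r * Real.cos θ) ^ 2) / 4
      = -(R ^ 2 + r ^ 2) / 4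
        + -(r * R / 2 * (Real.sin φ * Real.cos θ - Real.cos φ * Real.sin θ)) := by
    linear_combination (-R ^ 2 / 4) * h2 - r ^ 2 / 4 * h1
  rw [e1, e2, e3, e4]
  simp only [Real.exp_add]
  ring

theorem continuous_fQ (z : EuclideanSpace ℝ (Fin 2)) : Continuous (fQ z) := by
  unfold fQ η
  fun_prop

theorem lintegral_nuQ (z : EuclideanSpace ℝ (Fin 2)) {F : EuclideanSpace ℝ (Fin 2) → ℝ≥0∞}
    (hF : Measurable F) : ∫⁻ y, F y ∂nuQ z = ∫⁻ y, ENNReal.ofReal (fQ z y) * F y :=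
  lintegral_withDensity_eq_lintegral_mul _ (continuous_fQ z).measurable.ennreal_ofReal hF

/-! ### The angular coupling -/

/-- The density, with respect to the quantile variables, of the radial part of `ν_z`, `‖z‖ = r`. -/
noncomputable def radDens (r R : ℝ) : ℝ≥0∞ :=
  ENNReal.ofReal R * (ENNReal.ofReal ((4 * Real.pi)⁻¹ * Real.exp (-(R ^ 2 + r ^ 2) / 4)) *
    ENNReal.ofReal (angMean (r * R / 2)))

theorem measurable_radDens (r : ℝ) : Measurable (radDens r) := by
  have := continuous_angMean.measurable
  unfold radDens
  fun_prop

/-- Integration against `ν_z` in quantile coordinates. -/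
theorem lintegral_nuQ_polarPt (r θ Δ : ℝ) {F : EuclideanSpace ℝ (Fin 2) → ℝ≥0∞}
    (hF : Measurable F) :
    ∫⁻ y, F y ∂nuQ (polarPt r θ) = ∫⁻ R in Set.Ioi (0 : ℝ),
      ∫⁻ t in Set.Ioc (-Real.pi) (-Real.pi + 2 * Real.pi),
        radDens r R * F (polarPt R (θ + angQuantile (r * R / 2) (t - Δ))) := by
  rw [lintegral_nuQ _ hF, lintegral_eq_lintegral_polarPt
    (F := fun y => ENNReal.ofReal (fQ (polarPt r θ) y) * F y)
    ((continuous_fQ _).measurable.ennreal_ofReal.mul hF)]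
  refine lintegral_congr fun R => ?_
  have hper : Function.Periodic (fun ψ => F (polarPt R (θ + ψ))) (2 * Real.pi) := fun ψ => by
    simp only [← add_assoc, polarPt_add_two_pi]
  have hne : radDens r R ≠ ⊤ :=
    ENNReal.mul_ne_top ENNReal.ofReal_ne_top
      (ENNReal.mul_ne_top ENNReal.ofReal_ne_top ENNReal.ofReal_ne_top)
  rw [lintegral_const_mul' _ _ hne, radDens, mul_assoc, mul_assoc,
    ← setLIntegral_angDens_mul (r * R / 2) hper Δ,
    lintegral_const_mul' _ _ ENNReal.ofReal_ne_top]
  congr 1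
  have hper' : Function.Periodic (fun ψ => ENNReal.ofReal (angDens (r * R / 2) ψ) *
      F (polarPt R (θ + ψ))) (2 * Real.pi) := fun ψ => by
    have := hper ψ
    simp only at this
    simp only [this, periodic_angDens _ ψ]
  rw [← setLIntegral_Ioc_comp_sub_of_periodic Real.two_pi_pos hper' _ θ,
    ← lintegral_const_mul' _ _ ENNReal.ofReal_ne_top]
  refine lintegral_congr fun φ => ?_
  rw [fQ_polarPt, ENNReal.ofReal_mul (by positivity), add_sub_cancel, mul_assoc]

/-- The map sending radius and quantile to a pair of points on the circle of radius `R`. -/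
noncomputable def angPair (r θ₁ θ₂ : ℝ) (p : ℝ × ℝ) :
    EuclideanSpace ℝ (Fin 2) × EuclideanSpace ℝ (Fin 2) :=
  (polarPt p.1 (θ₁ + angQuantile (r * p.1 / 2) p.2),
    polarPt p.1 (θ₂ + angQuantile (r * p.1 / 2) (p.2 - (θ₂ - θ₁))))

theorem measurable_angPair (r θ₁ θ₂ : ℝ) : Measurable (angPair r θ₁ θ₂) := by
  have h (θ Δ : ℝ) : Measurable fun p : ℝ × ℝ =>
      polarPt p.1 (θ + angQuantile (r * p.1 / 2) (p.2 - Δ)) := by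
    refine measurable_polarPt_uncurry.comp
      (measurable_fst.prodMk (Measurable.const_add ?_ θ))
    exact measurable_angQuantile_uncurry.comp
      (f := fun p : ℝ × ℝ => (r * p.1 / 2, p.2 - Δ)) (by fun_prop)
  refine Measurable.prodMk ?_ (h _ _)
  simpa using h θ₁ 0

/-- The coupling of `ν_z` and `ν_w`, `‖z‖ = ‖w‖ = r`, which is monotone along circles. -/
noncomputable def angCoupling (r θ₁ θ₂ : ℝ) :
    Measure (EuclideanSpace ℝ (Fin 2) × EuclideanSpace ℝ (Fin 2)) :=
  (((volume.restrict (Set.Ioi 0)).prod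
    (volume.restrict (Set.Ioc (-Real.pi) (-Real.pi + 2 * Real.pi)))).withDensity
      fun p : ℝ × ℝ => radDens r p.1).map (angPair r θ₁ θ₂)

theorem lintegral_angCoupling (r θ₁ θ₂ : ℝ)
    {F : EuclideanSpace ℝ (Fin 2) × EuclideanSpace ℝ (Fin 2) → ℝ≥0∞} (hF : Measurable F) :
    ∫⁻ p, F p ∂angCoupling r θ₁ θ₂ = ∫⁻ R in Set.Ioi (0 : ℝ),
      ∫⁻ t in Set.Ioc (-Real.pi) (-Real.pi + 2 * Real.pi),
        radDens r R * F (angPair r θ₁ θ₂ (R, t)) := by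
  have hd : Measurable fun p : ℝ × ℝ => radDens r p.1 :=
    (measurable_radDens r).comp measurable_fst
  have hc : Measurable fun p => F (angPair r θ₁ θ₂ p) := hF.comp (measurable_angPair r θ₁ θ₂)
  rw [angCoupling, lintegral_map hF (measurable_angPair _ _ _),
    lintegral_withDensity_eq_lintegral_mul _ hd hc, lintegral_prod _ (hd.mul hc).aemeasurable]
  rfl

theorem isCoupling_angCoupling (r θ₁ θ₂ : ℝ) :
    IsCoupling (angCoupling r θ₁ θ₂) (nuQ (polarPt r θ₁)) (nuQ (polarPt r θ₂)) := by
  constructor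
  · refine Measure.ext_of_lintegral _ fun F hF => ?_
    rw [lintegral_map hF measurable_fst, lintegral_angCoupling _ _ _ (F := fun p => F p.1) (hF.comp measurable_fst),
     
      lintegral_nuQ_polarPt r θ₁ 0 hF]
    simp [angPair]
  · refine Measure.ext_of_lintegral _ fun F hF => ?_
    rw [lintegral_map hF measurable_snd, lintegral_angCoupling _ _ _ (F := fun p => F p.2) (hF.comp measurable_snd),
     
      lintegral_nuQ_polarPt r θ₂ (θ₂ - θ₁) hF]
    simp [angPair]

theorem quarterCost_nonneg (z w : EuclideanSpace ℝ (Fin 2)) : 0 ≤ quarterCost z w := by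
  simp [quarterCost]

theorem quarterCost_le (z w : EuclideanSpace ℝ (Fin 2)) : quarterCost z w ≤ ‖z - w‖ :=
  (min_le_left _ _).trans (min_le_left _ _)

theorem quarterCost_angPair_le {r : ℝ} (hr : 0 ≤ r) {R θ₁ θ₂ : ℝ} (hR : 0 ≤ R) (h : θ₁ ≤ θ₂)
    (t : ℝ) :
    quarterCost (angPair r θ₁ θ₂ (R, t)).1 (angPair r θ₁ θ₂ (R, t)).2
      ≤ R * ((r * R / 2) ^ 4 * Real.exp (r * R / 2) * (θ₂ - θ₁)) := by
  refine (quarterCost_le _ _).trans ((dist_polarPt_le hR _ _).trans ?_)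
  refine mul_le_mul_of_nonneg_left ?_ hR
  have := abs_angQuantile_sub_le (a := r * R / 2) (by positivity) t (sub_nonneg.2 h)
  rwa [show θ₁ + angQuantile (r * R / 2) t - (θ₂ + angQuantile (r * R / 2) (t - (θ₂ - θ₁)))
    = angQuantile (r * R / 2) t - angQuantile (r * R / 2) (t - (θ₂ - θ₁)) - (θ₂ - θ₁) by ring]

/-- A bound, up to the factor `r ^ 8`, for the cost of `angCoupling` per unit of squared angle. -/
noncomputable def angCostConst : ℝ≥0∞ :=
  ∫⁻ R in Set.Ioi (0 : ℝ), ∫⁻ _ in Set.Ioc (-Real.pi) (-Real.pi + 2 * Real.pi),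
    ENNReal.ofReal (R ^ 11 * (Real.exp 18 * Real.exp (-(1 / 8) * R ^ 2)))

theorem angCostConst_ne_top : angCostConst ≠ ⊤ := by
  have hi : Integrable fun R : ℝ => R ^ 11 * Real.exp (-(1 / 8) * R ^ 2) := by
    simpa only [← Real.rpow_natCast] using
      integrable_rpow_mul_exp_neg_mul_sq (b := 1 / 8) (by norm_num) (s := (11 : ℕ)) (by norm_num)
  have hi' := (hi.const_mul (Real.exp 18)).integrableOn (s := Set.Ioi 0)
  have hfin := hi'.lintegral_lt_top
  unfold angCostConst
  simp only [lintegral_const, Measure.restrict_apply_univ, Real.volume_Ioc]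
  rw [lintegral_mul_const' _ _ ENNReal.ofReal_ne_top]
  refine ENNReal.mul_ne_top ?_ ENNReal.ofReal_ne_top
  convert hfin.ne using 4
  ring

theorem transportCost_polarPt_le {r : ℝ} (hr : 0 ≤ r) (hr1 : r ≤ 1) {θ₁ θ₂ : ℝ} (h : θ₁ ≤ θ₂) :
    transportCost quarterCost (nuQ (polarPt r θ₁)) (nuQ (polarPt r θ₂))
      ≤ ENNReal.ofReal ((r ^ 4 * (θ₂ - θ₁)) ^ 2) * angCostConst := by
  refine (iInf₂_le (angCoupling r θ₁ θ₂) (isCoupling_angCoupling r θ₁ θ₂)).trans ?_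
  have hcont : Measurable fun p : EuclideanSpace ℝ (Fin 2) × EuclideanSpace ℝ (Fin 2) =>
      ENNReal.ofReal (quarterCost p.1 p.2 ^ 2) := by
    unfold quarterCost rot
    have hrot : Measurable fun p : EuclideanSpace ℝ (Fin 2) × EuclideanSpace ℝ (Fin 2) =>
        vec2 (-(p.2 1)) (p.2 0) :=
      measurable_vec2_uncurry.comp (f := fun p : EuclideanSpace ℝ (Fin 2) ×
        EuclideanSpace ℝ (Fin 2) => (-(p.2 1), p.2 0)) (by fun_prop)
    fun_prop
  rw [lintegral_angCoupling _ _ _ hcont, angCostConst,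
    ← lintegral_const_mul' _ _ ENNReal.ofReal_ne_top]
  refine setLIntegral_mono' measurableSet_Ioi fun R hR => ?_
  have hR : 0 < R := hR
  rw [← lintegral_const_mul' _ _ ENNReal.ofReal_ne_top]
  refine lintegral_mono fun t => ?_
  have hΔ : 0 ≤ θ₂ - θ₁ := sub_nonneg.2 h
  have hm := (angMean_pos (r * R / 2)).le
  rw [radDens, ← ENNReal.ofReal_mul (by positivity), ← ENNReal.ofReal_mul (by positivity),
    ← ENNReal.ofReal_mul (by positivity), ← ENNReal.ofReal_mul (by positivity)]
  refine ENNReal.ofReal_le_ofReal ?_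
  have hrR : r * R / 2 ≤ R / 2 := by nlinarith
  have h1 : angMean (r * R / 2) ≤ Real.exp (R / 2) :=
    (angMean_le_of_le fun x => angDens_le_exp (by positivity) x).trans (Real.exp_le_exp.2 hrR)
  have h2 : quarterCost (angPair r θ₁ θ₂ (R, t)).1 (angPair r θ₁ θ₂ (R, t)).2
      ≤ r ^ 4 * (θ₂ - θ₁) * (R ^ 5 * Real.exp (R / 2)) := by
    refine (quarterCost_angPair_le hr hR.le h t).trans ?_
    have he := Real.exp_le_exp.2 hrR
    calc R * ((r * R / 2) ^ 4 * Real.exp (r * R / 2) * (θ₂ - θ₁))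
        = (r ^ 4 * (θ₂ - θ₁) * R ^ 5) * ((1 / 16) * Real.exp (r * R / 2)) := by ring
      _ ≤ (r ^ 4 * (θ₂ - θ₁) * R ^ 5) * Real.exp (R / 2) := by
          refine mul_le_mul_of_nonneg_left ?_ (by positivity)
          linarith [Real.exp_pos (r * R / 2)]
      _ = _ := by ring
  have h3 : (4 * Real.pi)⁻¹ * Real.exp (-(R ^ 2 + r ^ 2) / 4) ≤ Real.exp (-R ^ 2 / 4) := by
    have : (4 * Real.pi)⁻¹ ≤ 1 := inv_le_one_of_one_le₀ (by linarith [Real.pi_gt_three])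
    refine (mul_le_of_le_one_left (Real.exp_pos _).le this).trans (Real.exp_le_exp.2 ?_)
    nlinarith [sq_nonneg r]
  calc R * ((4 * Real.pi)⁻¹ * Real.exp (-(R ^ 2 + r ^ 2) / 4) * angMean (r * R / 2)) *
        quarterCost (angPair r θ₁ θ₂ (R, t)).1 (angPair r θ₁ θ₂ (R, t)).2 ^ 2
      ≤ R * (Real.exp (-R ^ 2 / 4) * Real.exp (R / 2)) *
        (r ^ 4 * (θ₂ - θ₁) * (R ^ 5 * Real.exp (R / 2))) ^ 2 := by
        have := quarterCost_nonneg (angPair r θ₁ θ₂ (R, t)).1 (angPair r θ₁ θ₂ (R, t)).2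
        gcongr
    _ = (r ^ 4 * (θ₂ - θ₁)) ^ 2 * (R ^ 11 *
        (Real.exp (-R ^ 2 / 4) * Real.exp (R / 2) * Real.exp (R / 2) ^ 2)) := by ring
    _ ≤ (r ^ 4 * (θ₂ - θ₁)) ^ 2 * (R ^ 11 * (Real.exp 18 * Real.exp (-(1 / 8) * R ^ 2))) := by
        refine mul_le_mul_of_nonneg_left (mul_le_mul_of_nonneg_left ?_ (by positivity))
          (by positivity)
        rw [sq (Real.exp (R / 2)), ← Real.exp_add, ← Real.exp_add, ← Real.exp_add, ← Real.exp_add]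
        refine Real.exp_le_exp.2 ?_
        nlinarith [sq_nonneg (R - 6)]

theorem dtildeQ_polarPt_le {r : ℝ} (hr : 0 ≤ r) (hr1 : r ≤ 1) {θ₁ θ₂ : ℝ} (h : θ₁ ≤ θ₂) :
    dtildeQ (polarPt r θ₁) (polarPt r θ₂)
      ≤ Real.sqrt angCostConst.toReal * r ^ 4 * (θ₂ - θ₁) := by
  have hΔ : 0 ≤ θ₂ - θ₁ := sub_nonneg.2 h
  have hle := ENNReal.toReal_mono (ENNReal.mul_ne_top ENNReal.ofReal_ne_top angCostConst_ne_top)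
    (transportCost_polarPt_le hr hr1 h)
  rw [ENNReal.toReal_mul, ENNReal.toReal_ofReal (by positivity)] at hle
  refine (Real.sqrt_le_sqrt hle).trans (le_of_eq ?_)
  rw [Real.sqrt_mul (by positivity), Real.sqrt_sq (by positivity)]
  ring

theorem ellQ_le {r : ℝ} (hr : 0 ≤ r) (hr1 : r ≤ 1) :
    ellQ r ≤ ENNReal.ofReal (Real.sqrt angCostConst.toReal * r ^ 4 * (Real.pi / 2)) := by
  refine iSup_le fun N => iSup_le fun s => iSup_le fun hs => ENNReal.ofReal_le_ofReal ?_
  obtain ⟨h0, h1, hlt⟩ := hs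
  calc _ ≤ ∑ i ∈ Finset.range N, Real.sqrt angCostConst.toReal * r ^ 4 *
          (Real.pi * s (i + 1) / 2 - Real.pi * s i / 2) := by
        refine Finset.sum_le_sum fun i hi => dtildeQ_polarPt_le hr hr1 ?_
        have := (hlt i (Finset.mem_range.1 hi)).le
        gcongr
    _ = _ := by
        rw [← Finset.mul_sum, Finset.sum_range_sub (fun i => Real.pi * s i / 2), h0, h1]
        ring

/-! ### Moments of the lifted heat kernel measures -/

theorem η_nonneg (x : ℝ) : 0 ≤ η x := by
  unfold η
  positivity

theorem ofReal_η_sub (x a : ℝ) :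
    ENNReal.ofReal (η (x - a)) = ProbabilityTheory.gaussianPDF a 2 x := by
  have h : ((2 : NNReal) : ℝ) = 2 := rfl
  unfold η ProbabilityTheory.gaussianPDF ProbabilityTheory.gaussianPDFReal
  rw [h, show 2 * Real.pi * 2 = 4 * Real.pi by ring, show (2 : ℝ) * 2 = 4 by norm_num]

theorem lintegral_η_sub_mul (a : ℝ) {f : ℝ → ℝ≥0∞} (hf : Measurable f) :
    ∫⁻ x, ENNReal.ofReal (η (x - a)) * f x = ∫⁻ x, f x ∂ProbabilityTheory.gaussianReal a 2 := by
  rw [ProbabilityTheory.gaussianReal_of_var_ne_zero _ (by norm_num),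
    lintegral_withDensity_eq_lintegral_mul _ (ProbabilityTheory.measurable_gaussianPDF a 2) hf]
  simp only [ofReal_η_sub, Pi.mul_apply]

theorem lintegral_sq_gaussianReal_two (a : ℝ) :
    ∫⁻ x, ENNReal.ofReal (x ^ 2) ∂ProbabilityTheory.gaussianReal a 2
      = ENNReal.ofReal (2 + a ^ 2) := by
  have hL := ProbabilityTheory.memLp_id_gaussianReal (μ := a) (v := 2) 2
  have hv := ProbabilityTheory.variance_id_gaussianReal (μ := a) (v := 2)
  rw [ProbabilityTheory.variance_eq_sub (by exact_mod_cast hL)] at hv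
  have hm := ProbabilityTheory.integral_id_gaussianReal (μ := a) (v := 2)
  simp only [id, Pi.pow_apply, hm] at hv
  have hi : Integrable (fun x : ℝ => x ^ 2) (ProbabilityTheory.gaussianReal a 2) :=
    MemLp.integrable_sq (by exact_mod_cast hL)
  rw [← ofReal_integral_eq_lintegral_ofReal hi (Filter.Eventually.of_forall fun x => sq_nonneg x)]
  congr 1
  have : ((2 : NNReal) : ℝ) = 2 := rfl
  rw [this] at hv
  linarith

theorem lintegral_η_mul_η_mul (a b : ℝ) {f g : ℝ → ℝ≥0∞} (hf : Measurable f) (hg : Measurable g) :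
    ∫⁻ y : EuclideanSpace ℝ (Fin 2),
        ENNReal.ofReal (η (y 0 - a) * η (y 1 - b)) * (f (y 0) * g (y 1))
      = (∫⁻ x, f x ∂ProbabilityTheory.gaussianReal a 2) *
        ∫⁻ x, g x ∂ProbabilityTheory.gaussianReal b 2 := by
  have hη : Measurable η := by unfold η; fun_prop
  rw [← lintegral_η_sub_mul a hf, ← lintegral_η_sub_mul b hg,
    ← lintegral_prod_mul (by fun_prop) (by fun_prop), ← Measure.volume_eq_prod,
    ← measurePreserving_vec2.lintegral_comp (by fun_prop)]
  refine lintegral_congr fun p => ?_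
  rw [ENNReal.ofReal_mul (η_nonneg _)]
  simp only [vec2_apply_zero, vec2_apply_one]
  ring

theorem lintegral_η_mul_η (a b : ℝ) :
    ∫⁻ y : EuclideanSpace ℝ (Fin 2), ENNReal.ofReal (η (y 0 - a) * η (y 1 - b)) = 1 := by
  simpa using lintegral_η_mul_η_mul a b (f := 1) (g := 1) measurable_one measurable_one

theorem lintegral_η_mul_η_mul_norm_sq (a b : ℝ) :
    ∫⁻ y : EuclideanSpace ℝ (Fin 2),
        ENNReal.ofReal (η (y 0 - a) * η (y 1 - b)) * ENNReal.ofReal (‖y‖ ^ 2)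
      = ENNReal.ofReal (4 + (a ^ 2 + b ^ 2)) := by
  have hη : Measurable η := by unfold η; fun_prop
  have hsq : Measurable fun x : ℝ => ENNReal.ofReal (x ^ 2) := by fun_prop
  have h1 := lintegral_η_mul_η_mul a b (g := 1) hsq measurable_one
  have h2 := lintegral_η_mul_η_mul a b (f := 1) measurable_one hsq
  simp only [Pi.one_apply, lintegral_const, measure_univ, mul_one, one_mul,
    lintegral_sq_gaussianReal_two] at h1 h2
  have e : ENNReal.ofReal (4 + (a ^ 2 + b ^ 2))
      = ENNReal.ofReal (2 + a ^ 2) + ENNReal.ofReal (2 + b ^ 2) := by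
    rw [← ENNReal.ofReal_add (by positivity) (by positivity)]
    ring_nf
  rw [e, ← h1, ← h2, ← lintegral_add_left (by fun_prop)]
  refine lintegral_congr fun y => ?_
  rw [norm_sq_eq, ENNReal.ofReal_add (sq_nonneg _) (sq_nonneg _), mul_add]

theorem lintegral_nuQ_eq_average (z : EuclideanSpace ℝ (Fin 2))
    {F : EuclideanSpace ℝ (Fin 2) → ℝ≥0∞} (hF : Measurable F) {c : ℝ≥0∞}
    (h : ∀ a b : ℝ, a ^ 2 + b ^ 2 = ‖z‖ ^ 2 →
      ∫⁻ y : EuclideanSpace ℝ (Fin 2), ENNReal.ofReal (η (y 0 - a) * η (y 1 - b)) * F y = c) :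
    ∫⁻ y, F y ∂nuQ z = c := by
  have hη : Measurable η := by unfold η; fun_prop
  have hz := norm_sq_eq z
  have h1 := h (z 0) (z 1) hz.symm
  have h2 := h (-(z 1)) (z 0) (by rw [hz]; ring)
  have h3 := h (-(z 0)) (-(z 1)) (by rw [hz]; ring)
  have h4 := h (z 1) (-(z 0)) (by rw [hz]; ring)
  have key : ∀ y : EuclideanSpace ℝ (Fin 2), ENNReal.ofReal (fQ z y) * F y
      = ENNReal.ofReal 4⁻¹ * (ENNReal.ofReal (η (y 0 - z 0) * η (y 1 - z 1)) * F y
        + ENNReal.ofReal (η (y 0 - -(z 1)) * η (y 1 - z 0)) * F y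
        + ENNReal.ofReal (η (y 0 - -(z 0)) * η (y 1 - -(z 1))) * F y
        + ENNReal.ofReal (η (y 0 - z 1) * η (y 1 - -(z 0))) * F y) := by
    intro y
    have hn := fun u v => mul_nonneg (η_nonneg u) (η_nonneg v)
    have e : fQ z y = 4⁻¹ * (η (y 0 - z 0) * η (y 1 - z 1) + η (y 0 - -(z 1)) * η (y 1 - z 0)
        + η (y 0 - -(z 0)) * η (y 1 - -(z 1)) + η (y 0 - z 1) * η (y 1 - -(z 0))) := by
      simp only [fQ, rot, vec2_apply_zero, vec2_apply_one, sub_neg_eq_add, ← sub_eq_add_neg]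
    rw [e, ENNReal.ofReal_mul (by norm_num),
      ENNReal.ofReal_add (add_nonneg (add_nonneg (hn _ _) (hn _ _)) (hn _ _)) (hn _ _),
      ENNReal.ofReal_add (add_nonneg (hn _ _) (hn _ _)) (hn _ _),
      ENNReal.ofReal_add (hn _ _) (hn _ _)]
    ring
  rw [lintegral_nuQ z hF]
  simp only [key]
  rw [lintegral_const_mul' _ _ ENNReal.ofReal_ne_top, lintegral_add_left (by fun_prop),
    lintegral_add_left (by fun_prop), lintegral_add_left (by fun_prop), h1, h2, h3, h4]
  have : c + c + c + c = 4 * c := by ring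
  rw [this, ← mul_assoc, ENNReal.ofReal_inv_of_pos (by norm_num), ENNReal.ofReal_ofNat,
    ENNReal.inv_mul_cancel (by norm_num) (by norm_num), one_mul]

theorem nuQ_univ (z : EuclideanSpace ℝ (Fin 2)) : nuQ z Set.univ = 1 := by
  rw [← lintegral_one]
  exact lintegral_nuQ_eq_average z measurable_const fun a b _ => by
    simpa using lintegral_η_mul_η a b

instance isProbabilityMeasure_nuQ (z : EuclideanSpace ℝ (Fin 2)) :
    IsProbabilityMeasure (nuQ z) :=
  ⟨nuQ_univ z⟩

theorem lintegral_norm_sq_nuQ (z : EuclideanSpace ℝ (Fin 2)) :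
    ∫⁻ y, ENNReal.ofReal (‖y‖ ^ 2) ∂nuQ z = ENNReal.ofReal (4 + ‖z‖ ^ 2) :=
  lintegral_nuQ_eq_average z (by fun_prop) fun a b hab => by
    rw [lintegral_η_mul_η_mul_norm_sq, hab]

/-! ### Radial lower bound -/

theorem norm_rot (z : EuclideanSpace ℝ (Fin 2)) : ‖rot z‖ = ‖z‖ := by
  rw [← sq_eq_sq₀ (norm_nonneg _) (norm_nonneg _), norm_sq_eq, norm_sq_eq]
  simp only [rot, vec2_apply_zero, vec2_apply_one]
  ring

theorem abs_norm_sub_norm_le_quarterCost (z w : EuclideanSpace ℝ (Fin 2)) :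
    |‖w‖ - ‖z‖| ≤ quarterCost z w := by
  rw [abs_sub_comm]
  have hrot := norm_rot w
  refine le_min (le_min (abs_norm_sub_norm_le z w) ?_) (le_min ?_ ?_)
  · simpa [hrot] using abs_norm_sub_norm_le z (rot w)
  · simpa using abs_norm_sub_norm_le z (-w)
  · simpa [hrot] using abs_norm_sub_norm_le z (-rot w)

theorem IsCoupling.lintegral_fst {Y : Type*} [MeasurableSpace Y] {π : Measure (Y × Y)}
    {μ ν : Measure Y} (h : IsCoupling π μ ν) {f : Y → ℝ≥0∞} (hf : Measurable f) :
    ∫⁻ p, f p.1 ∂π = ∫⁻ y, f y ∂μ := by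
  rw [← h.1, lintegral_map hf measurable_fst]

theorem IsCoupling.lintegral_snd {Y : Type*} [MeasurableSpace Y] {π : Measure (Y × Y)}
    {μ ν : Measure Y} (h : IsCoupling π μ ν) {f : Y → ℝ≥0∞} (hf : Measurable f) :
    ∫⁻ p, f p.2 ∂π = ∫⁻ y, f y ∂ν := by
  rw [← h.2, lintegral_map hf measurable_snd]

theorem transportCost_nuQ_ne_top (z w : EuclideanSpace ℝ (Fin 2)) :
    transportCost quarterCost (nuQ z) (nuQ w) ≠ ⊤ := by
  have hc : IsCoupling ((nuQ z).prod (nuQ w)) (nuQ z) (nuQ w) :=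
    ⟨by simp [Measure.map_fst_prod], by simp [Measure.map_snd_prod]⟩
  have hm : Measurable fun y : EuclideanSpace ℝ (Fin 2) => 2 * ENNReal.ofReal (‖y‖ ^ 2) := by
    fun_prop
  refine ne_top_of_le_ne_top ?_ ((iInf₂_le ((nuQ z).prod (nuQ w)) hc).trans (lintegral_mono
    (g := fun p : EuclideanSpace ℝ (Fin 2) × EuclideanSpace ℝ (Fin 2) => 2 * ENNReal.ofReal (‖p.1‖ ^ 2) + 2 * ENNReal.ofReal (‖p.2‖ ^ 2)) fun p => ?_))
  · rw [lintegral_add_left (by fun_prop), hc.lintegral_fst hm, hc.lintegral_snd hm,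
      lintegral_const_mul' _ _ (by norm_num), lintegral_const_mul' _ _ (by norm_num),
      lintegral_norm_sq_nuQ, lintegral_norm_sq_nuQ]
    finiteness
  · have h2 (u : ℝ) : 2 * ENNReal.ofReal u = ENNReal.ofReal (2 * u) := by
      simp [ENNReal.ofReal_mul]
    simp only
    rw [h2, h2, ← ENNReal.ofReal_add (by positivity) (by positivity)]
    refine ENNReal.ofReal_le_ofReal ?_
    have h := (quarterCost_le p.1 p.2).trans (norm_sub_le p.1 p.2)
    have h' := pow_le_pow_left₀ (quarterCost_nonneg p.1 p.2) h 2
    nlinarith [sq_nonneg (‖p.1‖ - ‖p.2‖)]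

/-- The transport cost controls the difference of the second moments. -/
theorem le_transportCost_nuQ {z w : EuclideanSpace ℝ (Fin 2)} {s : ℝ} (hs : 0 < s) :
    ‖w‖ ^ 2 - ‖z‖ ^ 2 ≤ (2 * s)⁻¹ * (transportCost quarterCost (nuQ z) (nuQ w)).toReal
      + s * (8 + ‖z‖ ^ 2 + ‖w‖ ^ 2) := by
  have hm : Measurable fun y : EuclideanSpace ℝ (Fin 2) => ENNReal.ofReal (‖y‖ ^ 2) := by fun_prop
  have key : ENNReal.ofReal (4 + ‖w‖ ^ 2) ≤ ENNReal.ofReal (4 + ‖z‖ ^ 2)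
      + (ENNReal.ofReal s * (ENNReal.ofReal (4 + ‖z‖ ^ 2) + ENNReal.ofReal (4 + ‖w‖ ^ 2))
      + ENNReal.ofReal (2 * s)⁻¹ * transportCost quarterCost (nuQ z) (nuQ w)) := by
    have hinf : ENNReal.ofReal (2 * s)⁻¹ * transportCost quarterCost (nuQ z) (nuQ w)
        = ⨅ (π : Measure _) (_ : IsCoupling π (nuQ z) (nuQ w)),
          ENNReal.ofReal (2 * s)⁻¹ * ∫⁻ p, ENNReal.ofReal (quarterCost p.1 p.2 ^ 2) ∂π := by
      have h0 : ENNReal.ofReal (2 * s)⁻¹ ≠ 0 := by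
        simp only [ne_eq, ENNReal.ofReal_eq_zero, not_le]
        positivity
      simp only [transportCost, ENNReal.mul_iInf_of_ne h0 ENNReal.ofReal_ne_top]
    rw [hinf]
    simp only [ENNReal.add_iInf]
    refine le_iInf₂ fun π hπ => ?_
    rw [← lintegral_norm_sq_nuQ z, ← lintegral_norm_sq_nuQ w, ← hπ.lintegral_fst hm,
      ← hπ.lintegral_snd hm, ← lintegral_add_left (by fun_prop),
      ← lintegral_const_mul' _ _ ENNReal.ofReal_ne_top,
      ← lintegral_const_mul' _ _ ENNReal.ofReal_ne_top, ← lintegral_add_left (by fun_prop),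
      ← lintegral_add_left (by fun_prop)]
    refine lintegral_mono fun p => ?_
    rw [← ENNReal.ofReal_add (by positivity) (by positivity),
      ← ENNReal.ofReal_mul hs.le, ← ENNReal.ofReal_mul (by positivity),
      ← ENNReal.ofReal_add (by positivity) (by positivity),
      ← ENNReal.ofReal_add (by positivity) (by positivity)]
    refine ENNReal.ofReal_le_ofReal ?_
    have hc := abs_norm_sub_norm_le_quarterCost p.1 p.2
    have hc2 : (‖p.2‖ - ‖p.1‖) ^ 2 ≤ quarterCost p.1 p.2 ^ 2 := by
      rw [← sq_abs]
      exact pow_le_pow_left₀ (abs_nonneg _) hc 2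
    have hc3 := mul_le_mul_of_nonneg_left hc2 (by positivity : 0 ≤ (2 * s)⁻¹)
    have h4 : (‖p.2‖ - ‖p.1‖) * (‖p.2‖ + ‖p.1‖)
        ≤ (2 * s)⁻¹ * (‖p.2‖ - ‖p.1‖) ^ 2 + s / 2 * (‖p.2‖ + ‖p.1‖) ^ 2 := by
      have : (2 * s)⁻¹ * (‖p.2‖ - ‖p.1‖) ^ 2 + s / 2 * (‖p.2‖ + ‖p.1‖) ^ 2
          - (‖p.2‖ - ‖p.1‖) * (‖p.2‖ + ‖p.1‖)
          = (2 * s)⁻¹ * ((‖p.2‖ - ‖p.1‖) - s * (‖p.2‖ + ‖p.1‖)) ^ 2 := by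
        field_simp
        ring
      have h0 : 0 ≤ (2 * s)⁻¹ * ((‖p.2‖ - ‖p.1‖) - s * (‖p.2‖ + ‖p.1‖)) ^ 2 := by positivity
      linarith
    have h5 : s / 2 * (‖p.2‖ + ‖p.1‖) ^ 2 ≤ s * (‖p.1‖ ^ 2 + ‖p.2‖ ^ 2) := by
      nlinarith [mul_nonneg hs.le (sq_nonneg (‖p.1‖ - ‖p.2‖))]
    linarith
  rw [← ENNReal.ofReal_toReal (transportCost_nuQ_ne_top z w), ← ENNReal.ofReal_add (by positivity) (by positivity),
    ← ENNReal.ofReal_mul hs.le, ← ENNReal.ofReal_mul (by positivity),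
    ← ENNReal.ofReal_add (by positivity) (by positivity),
    ← ENNReal.ofReal_add (by positivity) (by positivity),
    ENNReal.ofReal_le_ofReal_iff (by positivity)] at key
  linarith

theorem le_dtildeQ_zero {r : ℝ} (hr : 0 < r) (hr1 : r ≤ 1) :
    r ^ 2 / 5 ≤ dtildeQ 0 (vec2 r 0) := by
  have hn : ‖vec2 r 0‖ ^ 2 = r ^ 2 := by simp [norm_sq_eq]
  have h := le_transportCost_nuQ (z := 0) (w := vec2 r 0) (s := r ^ 2 / 18) (by positivity)
  rw [hn, norm_zero] at h
  set C := (transportCost quarterCost (nuQ 0) (nuQ (vec2 r 0))).toReal with hC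
  have hr2 : r ^ 2 ≤ 1 := by nlinarith
  have h1 : r ^ 2 / 18 * (8 + 0 ^ 2 + r ^ 2) ≤ r ^ 2 / 2 := by nlinarith [sq_nonneg r]
  have h2 : r ^ 2 / 2 ≤ (2 * (r ^ 2 / 18))⁻¹ * C := by linarith
  rw [inv_mul_eq_div, le_div_iff₀ (by positivity)] at h2
  refine Real.le_sqrt_of_sq_le ?_
  nlinarith [sq_nonneg (r ^ 2)]

theorem le_rhoQ {r : ℝ} (hr : 0 < r) (hr1 : r ≤ 1) : ENNReal.ofReal (r ^ 2 / 5) ≤ rhoQ r := by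
  refine le_iInf₂ fun γ hγ => ?_
  refine le_iSup_of_le 1 (le_iSup_of_le (fun n : ℕ => (n : ℝ)) (le_iSup_of_le ?_ ?_))
  · exact ⟨by simp, by simp, by simp⟩
  · refine ENNReal.ofReal_le_ofReal ?_
    simpa [hγ.2.1, hγ.2.2] using le_dtildeQ_zero hr hr1

/-- for the Gigli–Mantegazza distance `d₁`, the cone `C(π/2)` has angle
zero at the apex: `ℓ(r)/ρ(r) → 0` as `r → 0⁺`. -/
theorem stmt18 :
    Filter.Tendsto (fun r : ℝ => (ellQ r).toReal / (rhoQ r).toReal)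
      (nhdsWithin 0 (Set.Ioi 0)) (nhds 0) := by
  set A := Real.sqrt angCostConst.toReal * (Real.pi / 2) * 5 with hA
  have hlim : Filter.Tendsto (fun r : ℝ => A * r ^ 2) (nhdsWithin 0 (Set.Ioi 0)) (nhds 0) := by
    have : Continuous fun r : ℝ => A * r ^ 2 := by fun_prop
    simpa using (this.tendsto 0).mono_left nhdsWithin_le_nhds
  refine tendsto_of_tendsto_of_tendsto_of_le_of_le' tendsto_const_nhds hlim
    (Filter.Eventually.of_forall fun r => by positivity) ?_
  filter_upwards [Ioc_mem_nhdsGT (zero_lt_one' ℝ)] with r hr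
  obtain ⟨hr0, hr1⟩ := hr
  have hA0 : 0 ≤ A := by positivity
  by_cases htop : rhoQ r = ⊤
  · rw [htop]
    simpa using mul_nonneg hA0 (sq_nonneg r)
  have hell := ENNReal.toReal_mono ENNReal.ofReal_ne_top (ellQ_le hr0.le hr1)
  rw [ENNReal.toReal_ofReal (by positivity)] at hell
  have hrho := ENNReal.toReal_mono htop (le_rhoQ hr0 hr1)
  rw [ENNReal.toReal_ofReal (by positivity)] at hrho
  rw [div_le_iff₀ (lt_of_lt_of_le (by positivity) hrho)]
  calc (ellQ r).toReal ≤ Real.sqrt angCostConst.toReal * r ^ 4 * (Real.pi / 2) := hell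
    _ = A * r ^ 2 * (r ^ 2 / 5) := by rw [hA]; ring
    _ ≤ _ := mul_le_mul_of_nonneg_left hrho (by positivity)
end
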